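/- arXiv:1006.2416 — 2 statements merged into one kernel-verified Lean document; each statement's English description precedes it below -/
import Mathlib

section
/- (Klee) (1) Let P ⊆ ℝ³ be a polytope (the convex hull of a nonempty finite set) of dimension 3 with exactly n facets. Then any two extreme points of P are joined by a path in the graph G(P) of length at most ⌊2n/3⌋ − 1. (2) For every n ≥ 4 there exists a polytope P ⊆ ℝ³ of dimension 3 with exactly n facets having two extreme points whose graph distance in G(P) is at least ⌊2n/3⌋ − 1. (Hence H(n,3) = ⌊2n/3⌋ − 1.) -/
open scoped BigOperators

noncomputable section

/-- Adjacency in the graph of a convex set `P`: two distinct extreme points whose closed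
segment is a face of `P`. -/
def PolyAdj {E : Type*} [AddCommGroup E] [Module ℝ E] (P : Set E) (a b : E) : Prop :=
  a ≠ b ∧ a ∈ Set.extremePoints ℝ P ∧ b ∈ Set.extremePoints ℝ P ∧
    IsExtreme ℝ P (segment ℝ a b)

/-- A path of length `L` in the graph of `P` from `a` to `b`. -/
def HasPathOfLength {E : Type*} [AddCommGroup E] [Module ℝ E] (P : Set E) (a b : E)
    (L : ℕ) : Prop :=
  ∃ f : ℕ → E, f 0 = a ∧ f L = b ∧ ∀ i < L, PolyAdj P (f i) (f (i + 1))

/-- A face of a convex set `P`: a convex extreme subset. -/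
def IsFace {E : Type*} [AddCommGroup E] [Module ℝ E] (P F : Set E) : Prop :=
  Convex ℝ F ∧ IsExtreme ℝ P F

/-- The dimension of a set: the rank of the direction of its affine span. -/
noncomputable def setDim {E : Type*} [AddCommGroup E] [Module ℝ E] (S : Set E) : ℕ :=
  Module.finrank ℝ (affineSpan ℝ S).direction

/-- A facet of `P` is a face of dimension `dim P - 1`. -/
def IsFacet {E : Type*} [AddCommGroup E] [Module ℝ E] (P F : Set E) : Prop :=
  IsFace P F ∧ setDim F = setDim P - 1

/-- The number of facets of `P`. -/
noncomputable def numFacets {E : Type*} [AddCommGroup E] [Module ℝ E] (P : Set E) : ℕ :=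
  Set.ncard {F : Set E | IsFacet P F}

section Polytope

variable {E : Type*} [AddCommGroup E] [Module ℝ E]

theorem IsExtreme.subset_convexHull_inter {V : Finset E} {F : Set E}
    (hF : IsExtreme ℝ (convexHull ℝ (V : Set E)) F) :
    F ⊆ convexHull ℝ ((V : Set E) ∩ F) := by
  classical
  intro x hx
  obtain ⟨w, hw0, hw1, hwx⟩ := Finset.mem_convexHull'.1 (hF.subset hx)
  have key : ∀ v ∈ V, w v ≠ 0 → v ∈ F := by
    intro v hv hwv
    have hpos : 0 < w v := lt_of_le_of_ne (hw0 v hv) (Ne.symm hwv)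
    have hsplit : w v + ∑ y ∈ V.erase v, w y = 1 := by
      rw [Finset.add_sum_erase _ _ hv, hw1]
    have hsplit' : w v • v + ∑ y ∈ V.erase v, w y • y = x := by
      rw [Finset.add_sum_erase _ (fun y => w y • y) hv, hwx]
    have hr0 : 0 ≤ ∑ y ∈ V.erase v, w y :=
      Finset.sum_nonneg fun y hy => hw0 y (Finset.mem_of_mem_erase hy)
    rcases hr0.eq_or_lt with h0 | h0
    · have hz : ∀ y ∈ V.erase v, w y = 0 :=
        (Finset.sum_eq_zero_iff_of_nonneg
          fun y hy => hw0 y (Finset.mem_of_mem_erase hy)).1 h0.symm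
      rw [Finset.sum_eq_zero (fun y hy => by rw [hz y hy, zero_smul])] at hsplit'
      have : w v = 1 := by linarith
      rw [this] at hsplit'
      simp only [one_smul, add_zero] at hsplit'
      rwa [hsplit']
    · have hy : (V.erase v).centerMass w id ∈ convexHull ℝ (V : Set E) := by
        apply Finset.centerMass_mem_convexHull
        · exact fun y hy => hw0 y (Finset.mem_of_mem_erase hy)
        · exact h0
        · exact fun y hy => Finset.mem_coe.2 (Finset.mem_of_mem_erase hy)
      refine hF.left_mem_of_mem_openSegment (subset_convexHull ℝ _ (Finset.mem_coe.2 hv)) hy hx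
        ⟨w v, ∑ y ∈ V.erase v, w y, hpos, h0, hsplit, ?_⟩
      rw [Finset.centerMass, smul_smul, mul_inv_cancel₀ h0.ne', one_smul]
      simpa using hsplit'
  have hsum : ∑ y ∈ V with y ∈ F, w y = 1 := by
    rw [← hw1]
    exact Finset.sum_filter_of_ne fun y hy h => key y hy h
  have hsum' : ∑ y ∈ V with y ∈ F, w y • y = x := by
    rw [← hwx]
    exact Finset.sum_filter_of_ne fun y hy h => key y hy fun h0 => h (by rw [h0, zero_smul])
  have : ((V : Set E) ∩ F) = ((V.filter (· ∈ F) : Finset E) : Set E) := by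
    ext y; simp
  rw [this]
  exact Finset.mem_convexHull'.2 ⟨w, fun y hy => hw0 y (Finset.mem_filter.1 hy).1, hsum, hsum'⟩

theorem IsFace.eq_convexHull_inter {V : Finset E} {F : Set E}
    (hF : IsFace (convexHull ℝ (V : Set E)) F) : F = convexHull ℝ ((V : Set E) ∩ F) :=
  (hF.2.subset_convexHull_inter).antisymm (convexHull_min Set.inter_subset_right hF.1)

theorem finite_setOf_isFace (V : Finset E) :
    {F : Set E | IsFace (convexHull ℝ (V : Set E)) F}.Finite := by
  refine ((V.finite_toSet.powerset).image fun A => convexHull ℝ A).subset ?_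
  intro F hF
  exact ⟨(V : Set E) ∩ F, Set.inter_subset_left, hF.eq_convexHull_inter.symm⟩

theorem exists_relative_center {T : Finset E} (hT : T.Nonempty) :
    ∃ r ∈ convexHull ℝ (T : Set E), ∀ x ∈ affineSpan ℝ (T : Set E),
      ∃ t : ℝ, 0 < t ∧ r + t • (r - x) ∈ convexHull ℝ (T : Set E) := by
  classical
  have hm : (0 : ℝ) < T.card := by exact_mod_cast hT.card_pos
  refine ⟨∑ y ∈ T, (T.card : ℝ)⁻¹ • y, Finset.mem_convexHull'.2
    ⟨fun _ => (T.card : ℝ)⁻¹, fun _ _ => by positivity, by simp [hm.ne'], rfl⟩, ?_⟩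
  intro x hx
  have hrange : (T : Set E) = Set.range ((↑) : T → E) := by simp
  rw [hrange] at hx
  obtain ⟨w, hw1, hwx⟩ := eq_affineCombination_of_mem_affineSpan_of_fintype hx
  rw [Finset.affineCombination_eq_linear_combination _ _ _ hw1] at hwx
  set u : E → ℝ := fun y => if h : y ∈ T then w ⟨y, h⟩ else 0 with hu
  have hu1 : ∑ y ∈ T, u y = 1 := by
    rw [← hw1, ← Finset.sum_coe_sort T]
    exact Finset.sum_congr rfl fun y _ => by simp [hu]
  have hux : ∑ y ∈ T, u y • y = x := by
    rw [hwx, ← Finset.sum_coe_sort T]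
    exact Finset.sum_congr rfl fun y _ => by simp [hu]
  set M : ℝ := 1 + ∑ y ∈ T, |u y| with hM
  have hMpos : 0 < M := by positivity
  refine ⟨(T.card : ℝ)⁻¹ * M⁻¹, by positivity, Finset.mem_convexHull'.2
    ⟨fun y => (T.card : ℝ)⁻¹ + ((T.card : ℝ)⁻¹ * M⁻¹) * ((T.card : ℝ)⁻¹ - u y), ?_, ?_, ?_⟩⟩
  · intro y hy
    have h1 : u y ≤ M := by
      have := Finset.single_le_sum (f := fun y => |u y|) (fun i _ => abs_nonneg _) hy
      have := le_abs_self (u y)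
      linarith
    have h2 : M⁻¹ * u y ≤ 1 := by
      rw [inv_mul_le_iff₀ hMpos]; linarith
    have h3 : 0 < (T.card : ℝ)⁻¹ := by positivity
    have h4 : 0 < M⁻¹ := by positivity
    beta_reduce
    have : (T.card : ℝ)⁻¹ + ((T.card : ℝ)⁻¹ * M⁻¹) * ((T.card : ℝ)⁻¹ - u y)
      = (T.card : ℝ)⁻¹ * ((1 - M⁻¹ * u y) + M⁻¹ * (T.card : ℝ)⁻¹) := by ring
    rw [this]
    have : 0 ≤ 1 - M⁻¹ * u y := by linarith
    positivity
  · rw [Finset.sum_add_distrib, ← Finset.mul_sum, Finset.sum_sub_distrib, hu1]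
    simp [hm.ne']
  · simp only [add_smul, mul_smul, sub_smul, smul_sub, Finset.sum_add_distrib,
      Finset.sum_sub_distrib, Finset.smul_sum, ← hux]

theorem IsFace.exists_relative_center {V : Finset E} {F : Set E}
    (hF : IsFace (convexHull ℝ (V : Set E)) F) (hne : F.Nonempty) :
    ∃ r ∈ F, ∀ x ∈ affineSpan ℝ F, ∃ t : ℝ, 0 < t ∧ r + t • (r - x) ∈ F := by
  classical
  have hcoe : ((V : Set E) ∩ F) = ((V.filter (· ∈ F) : Finset E) : Set E) := by
    ext y; simp
  have hFT : F = convexHull ℝ ((V.filter (· ∈ F) : Finset E) : Set E) := by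
    rw [← hcoe]; exact hF.eq_convexHull_inter
  have hT : (V.filter (· ∈ F)).Nonempty := by
    rw [hFT, convexHull_nonempty_iff] at hne
    exact_mod_cast hne
  obtain ⟨r, hr, h⟩ := _root_.exists_relative_center hT
  rw [← hFT] at hr
  refine ⟨r, hr, fun x hx => ?_⟩
  rw [hFT, affineSpan_convexHull] at hx
  obtain ⟨t, ht, h'⟩ := h x hx
  exact ⟨t, ht, by rw [hFT]; exact h'⟩

theorem mem_openSegment_extension {r x : E} {t : ℝ} (ht : 0 < t) :
    r ∈ openSegment ℝ x (r + t • (r - x)) := by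
  refine ⟨t / (1 + t), 1 / (1 + t), by positivity, by positivity, by field_simp; ring, ?_⟩
  have h : (1 + t) ≠ 0 := by positivity
  match_scalars
  · field_simp
    ring
  · field_simp

/-- A nonempty face of a polytope is cut out by its affine span. -/
theorem IsFace.mem_of_mem_affineSpan {V : Finset E} {F : Set E}
    (hF : IsFace (convexHull ℝ (V : Set E)) F) {x : E} (hx : x ∈ convexHull ℝ (V : Set E))
    (hxF : x ∈ affineSpan ℝ F) : x ∈ F := by
  have hne : F.Nonempty := (affineSpan_nonempty ℝ).1 ⟨x, hxF⟩
  obtain ⟨r, hr, h⟩ := hF.exists_relative_center hne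
  obtain ⟨t, ht, h'⟩ := h x hxF
  exact hF.2.left_mem_of_mem_openSegment hx (hF.2.subset h') hr (mem_openSegment_extension ht)

/-- The points of a polytope maximizing a linear form make up a face. -/
theorem isFace_setOf_eq {P : Set E} (hP : Convex ℝ P) (f : Module.Dual ℝ E) {c : ℝ}
    (hf : ∀ x ∈ P, f x ≤ c) : IsFace P {x ∈ P | f x = c} := by
  refine ⟨?_, ?_, ?_⟩
  · intro x hx y hy a b ha hb hab
    refine ⟨hP hx.1 hy.1 ha hb hab, ?_⟩
    rw [map_add, map_smul, map_smul, hx.2, hy.2, ← add_smul, hab, one_smul]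
  · exact fun x hx => hx.1
  · rintro x hx y hy z hz ⟨a, b, ha, hb, hab, rfl⟩
    refine ⟨hx, ?_⟩
    have h1 := hf x hx
    have h2 := hf y hy
    have h3 := hz.2
    rw [map_add, map_smul, map_smul, smul_eq_mul, smul_eq_mul] at h3
    by_contra hne
    have h4 : f x < c := lt_of_le_of_ne h1 hne
    have : a * f x + b * f y < a * c + b * c := by
      have := mul_lt_mul_of_pos_left h4 ha
      have := mul_le_mul_of_nonneg_left h2 hb.le
      linarith
    rw [h3, ← add_mul, hab, one_mul] at this
    exact lt_irrefl _ this

theorem apply_le_of_mem_convexHull {A : Set E} (f : Module.Dual ℝ E) {c : ℝ}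
    (hf : ∀ x ∈ A, f x ≤ c) : ∀ x ∈ convexHull ℝ A, f x ≤ c := fun _ hx =>
  convexHull_min (t := {x | f x ≤ c}) hf (convex_halfSpace_le f.isLinear c) hx

theorem isFace_convexHull_setOf_eq {V : Finset E} (f : Module.Dual ℝ E) {c : ℝ}
    (hf : ∀ x ∈ V, f x ≤ c) :
    IsFace (convexHull ℝ (V : Set E)) {x ∈ convexHull ℝ (V : Set E) | f x = c} :=
  isFace_setOf_eq (convex_convexHull ℝ _) f (apply_le_of_mem_convexHull f hf)

/-- Two vertices which are the only maximizers of a linear form are adjacent. -/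
theorem polyAdj_of_forall {V : Finset E}
    (hV : ∀ v ∈ V, v ∈ Set.extremePoints ℝ (convexHull ℝ (V : Set E))) {v w : E}
    (hv : v ∈ V) (hw : w ∈ V) (hne : v ≠ w) (f : Module.Dual ℝ E) {c : ℝ}
    (hf : ∀ x ∈ V, f x ≤ c) (hfv : f v = c) (hfw : f w = c)
    (h : ∀ x ∈ V, f x = c → x = v ∨ x = w) : PolyAdj (convexHull ℝ (V : Set E)) v w := by
  refine ⟨hne, hV v hv, hV w hw, ?_⟩
  have hface := isFace_convexHull_setOf_eq f hf
  have : (V : Set E) ∩ {x ∈ convexHull ℝ (V : Set E) | f x = c} = {v, w} := by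
    ext x
    constructor
    · rintro ⟨hx, -, hx'⟩
      exact h x hx hx'
    · rintro (rfl | rfl)
      · exact ⟨hv, subset_convexHull ℝ _ hv, hfv⟩
      · exact ⟨hw, subset_convexHull ℝ _ hw, hfw⟩
  have h2 := hface.eq_convexHull_inter
  rw [this, convexHull_pair] at h2
  rw [← h2]
  exact hface.2

theorem PolyAdj.symm {P : Set E} {a b : E} (h : PolyAdj P a b) : PolyAdj P b a :=
  ⟨h.1.symm, h.2.2.1, h.2.1, segment_symm ℝ a b ▸ h.2.2.2⟩

end Polytope

section Graph

theorem exists_dual_pos_and_ne_zero {E : Type*} [AddCommGroup E] [Module ℝ E]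
    (g₀ : Module.Dual ℝ E) (D N : Finset E) (hD : ∀ d ∈ D, 0 < g₀ d) (hN : ∀ n ∈ N, n ≠ 0) :
    ∃ g : Module.Dual ℝ E, (∀ d ∈ D, 0 < g d) ∧ ∀ n ∈ N, g n ≠ 0 := by
  obtain ⟨g₁, hg₁⟩ := Module.exists_dual_forall_apply_ne_zero (K := ℝ) (fun n : N => (n : E))
    fun n => hN n n.2
  have h1 : ∀ d ∈ D, ∀ᶠ t : ℝ in nhdsWithin 0 (Set.Ioi 0), 0 < (g₀ + t • g₁) d := by
    intro d hd
    have hc : Continuous fun t : ℝ => (g₀ + t • g₁) d := by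
      simp only [LinearMap.add_apply, LinearMap.smul_apply, smul_eq_mul]
      fun_prop
    have h0 : (0 : ℝ) < (g₀ + (0 : ℝ) • g₁) d := by simpa using hD d hd
    exact ((hc.tendsto 0).eventually (lt_mem_nhds h0)).filter_mono nhdsWithin_le_nhds
  have h2 : ∀ n ∈ N, ∀ᶠ t : ℝ in nhdsWithin 0 (Set.Ioi 0), (g₀ + t • g₁) n ≠ 0 := by
    intro n hn
    by_cases h0 : g₀ n = 0
    · filter_upwards [self_mem_nhdsWithin] with t ht
      simp only [LinearMap.add_apply, LinearMap.smul_apply, smul_eq_mul, h0, zero_add]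
      exact mul_ne_zero (ne_of_gt ht) (hg₁ ⟨n, hn⟩)
    · have hc : Continuous fun t : ℝ => (g₀ + t • g₁) n := by
        simp only [LinearMap.add_apply, LinearMap.smul_apply, smul_eq_mul]
        fun_prop
      have h0 : (g₀ + (0 : ℝ) • g₁) n ≠ 0 := by simpa using h0
      exact ((hc.tendsto 0).eventually_ne h0).filter_mono nhdsWithin_le_nhds
  obtain ⟨t, ht1, ht2⟩ :=
    (((Filter.eventually_all_finset D).2 h1).and ((Filter.eventually_all_finset N).2 h2)).exists
  exact ⟨_, ht1, ht2⟩

variable {E : Type*} [NormedAddCommGroup E] [NormedSpace ℝ E] {V : Finset E}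

theorem exists_dual_exposing
    (hV : ∀ v ∈ V, v ∈ Set.extremePoints ℝ (convexHull ℝ (V : Set E))) {v : E} (hv : v ∈ V) :
    ∃ g : Module.Dual ℝ E, ∀ w ∈ V, w ≠ v → g w < g v := by
  have h1 := ((convex_convexHull ℝ _).mem_extremePoints_iff_mem_sdiff_convexHull_sdiff.1
    (hV v hv)).2
  have h2 : v ∉ convexHull ℝ ((V : Set E) \ {v}) := fun h =>
    h1 (convexHull_mono (Set.sdiff_subset_sdiff_left (subset_convexHull ℝ _)) h)
  obtain ⟨f, u, hf, hu⟩ := geometric_hahn_banach_closed_point (convex_convexHull ℝ _)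
    ((V.finite_toSet.subset Set.sdiff_subset).isClosed_convexHull ℝ) h2
  exact ⟨f.toLinearMap, fun w hw hne =>
    (hf w (subset_convexHull ℝ _ ⟨hw, hne⟩)).trans hu⟩

theorem smul_sub_ne_smul_sub {P : Set E} {v w₁ w₂ : E} {a b : ℝ} (hv : v ∈ P) (hw₁ : w₁ ∈ P)
    (hw₂ : w₂ ∈ Set.extremePoints ℝ P) (hne : w₂ ≠ v) (hb : 0 < b) (hab : b < a) :
    a • (w₂ - v) ≠ b • (w₁ - v) := by
  intro h
  have ha : 0 < a := hb.trans hab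
  refine hne (hw₂.2 hv hw₁ ⟨1 - b / a, b / a, ?_, by positivity, by ring, ?_⟩).symm
  · rw [sub_pos, div_lt_one ha]; exact hab
  · have : w₂ - v = (b / a) • (w₁ - v) := by
      rw [div_eq_inv_mul, mul_smul, ← h, smul_smul, inv_mul_cancel₀ ha.ne', one_smul]
    rw [sub_eq_iff_eq_add] at this
    rw [this]
    module

/-- The simplex step: a vertex not maximizing `f` has a neighbour with larger `f`. -/
theorem exists_polyAdj_lt
    (hV : ∀ v ∈ V, v ∈ Set.extremePoints ℝ (convexHull ℝ (V : Set E))) {v : E} (hv : v ∈ V)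
    (f : Module.Dual ℝ E) (hf : ∃ w ∈ V, f v < f w) :
    ∃ w ∈ V, PolyAdj (convexHull ℝ (V : Set E)) v w ∧ f v < f w := by
  classical
  have hVP : ∀ v ∈ V, v ∈ convexHull ℝ (V : Set E) := fun v hv => (hV v hv).1
  set U := V.filter fun w => f v < f w with hU
  have hUV : ∀ w ∈ U, w ∈ V ∧ f v < f w := fun w hw => Finset.mem_filter.1 hw
  have hUne : U.Nonempty := by
    obtain ⟨w, hw, h⟩ := hf
    exact ⟨w, Finset.mem_filter.2 ⟨hw, h⟩⟩
  have hne : ∀ w, f v < f w → w ≠ v := fun w h h' => by rw [h'] at h; exact lt_irrefl _ h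
  set N : Finset E := ((U ×ˢ U).filter fun p => p.1 ≠ p.2).image fun p =>
    (f p.1 - f v) • (p.2 - v) - (f p.2 - f v) • (p.1 - v) with hN
  obtain ⟨g₀, hg₀⟩ := exists_dual_exposing hV hv
  obtain ⟨g, hgD, hgN⟩ := exists_dual_pos_and_ne_zero g₀ ((V.erase v).image fun w => v - w) N
    (by
      intro d hd
      obtain ⟨w, hw, rfl⟩ := Finset.mem_image.1 hd
      rw [map_sub, sub_pos]
      exact hg₀ w (Finset.mem_of_mem_erase hw) (Finset.ne_of_mem_erase hw))
    (by
      intro n hn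
      obtain ⟨⟨w₁, w₂⟩, hp, rfl⟩ := Finset.mem_image.1 hn
      obtain ⟨hp, hne'⟩ := Finset.mem_filter.1 hp
      obtain ⟨h1, h2⟩ := Finset.mem_product.1 hp
      obtain ⟨h1, h1'⟩ := hUV _ h1
      obtain ⟨h2, h2'⟩ := hUV _ h2
      simp only at *
      rw [sub_ne_zero]
      rcases lt_trichotomy (f w₁) (f w₂) with h | h | h
      · exact (smul_sub_ne_smul_sub (hVP v hv) (hVP w₂ h2) (hV w₁ h1) (hne _ h1')
          (sub_pos.2 h1') (sub_lt_sub_right h _)).symm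
      · rw [h]
        intro h'
        have := smul_right_injective E (sub_pos.2 h2').ne' h'
        exact hne' (sub_left_injective this).symm
      · exact (smul_sub_ne_smul_sub (hVP v hv) (hVP w₁ h1) (hV w₂ h2) (hne _ h2')
          (sub_pos.2 h2') (sub_lt_sub_right h _)))
  have hg : ∀ w ∈ V, w ≠ v → 0 < g v - g w := by
    intro w hw hwv
    rw [← map_sub]
    exact hgD _ (Finset.mem_image_of_mem _ (Finset.mem_erase.2 ⟨hwv, hw⟩))
  obtain ⟨w, hw, hmax⟩ := Finset.exists_max_image U (fun w => (f w - f v) / (g v - g w)) hUne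
  obtain ⟨hwV, hfw⟩ := hUV w hw
  have hgw := hg w hwV (hne w hfw)
  set l := (f w - f v) / (g v - g w) with hl
  have hlpos : 0 < l := div_pos (sub_pos.2 hfw) hgw
  have hle : ∀ x ∈ U, f x - f v ≤ l * (g v - g x) := by
    intro x hx
    obtain ⟨hxV, hfx⟩ := hUV x hx
    exact (div_le_iff₀ (hg x hxV (hne x hfx))).1 (hmax x hx)
  have hlw : f w - f v = l * (g v - g w) := by rw [hl, div_mul_cancel₀ _ hgw.ne']
  have hnonneg : ∀ x ∈ V, 0 ≤ g v - g x := by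
    intro x hx
    by_cases h : x = v
    · rw [h, sub_self]
    · exact (hg x hx h).le
  refine ⟨w, hwV, polyAdj_of_forall hV hv hwV (hne w hfw).symm (f + l • g) (c := f v + l * g v)
    ?_ ?_ ?_ ?_, hfw⟩
  · intro x hx
    simp only [LinearMap.add_apply, LinearMap.smul_apply, smul_eq_mul]
    by_cases h : f v < f x
    · have := hle x (Finset.mem_filter.2 ⟨hx, h⟩)
      linarith
    · have := mul_nonneg hlpos.le (hnonneg x hx)
      linarith
  · simp
  · simp only [LinearMap.add_apply, LinearMap.smul_apply, smul_eq_mul]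
    linarith
  · intro x hx heq
    simp only [LinearMap.add_apply, LinearMap.smul_apply, smul_eq_mul] at heq
    by_contra! hcon
    have hgx := hg x hx hcon.1
    have h1 : f x - f v = l * (g v - g x) := by linarith
    have hfx : f v < f x := by
      have := mul_pos hlpos hgx
      linarith
    refine hgN ((f w - f v) • (x - v) - (f x - f v) • (w - v)) (Finset.mem_image.2
      ⟨(w, x), Finset.mem_filter.2 ⟨Finset.mem_product.2 ⟨hw, Finset.mem_filter.2 ⟨hx, hfx⟩⟩,
        hcon.2.symm⟩, rfl⟩) ?_
    simp only [map_sub, map_smul, smul_eq_mul]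
    rw [h1, hlw]
    ring

/-- Adjacency in the graph of `P` with the vertices `x` and `y` removed. -/
def AdjAvoiding (P : Set E) (x y : E) (u w : E) : Prop :=
  PolyAdj P u w ∧ (u ≠ x ∧ u ≠ y) ∧ (w ≠ x ∧ w ≠ y)

theorem AdjAvoiding.symm {P : Set E} {x y u w : E} (h : AdjAvoiding P x y u w) :
    AdjAvoiding P x y w u := ⟨h.1.symm, h.2.2, h.2.1⟩

theorem reflTransGen_adjAvoiding_symm {P : Set E} {x y u w : E}
    (h : Relation.ReflTransGen (AdjAvoiding P x y) u w) :
    Relation.ReflTransGen (AdjAvoiding P x y) w u := by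
  induction h with
  | refl => exact .refl
  | tail _ h ih => exact .head h.symm ih

/-- All vertices on the nonnegative side of a hyperplane through `x` and `y` can be connected to a
common vertex without passing through `x` and `y`. -/
theorem exists_forall_reflTransGen
    (hV : ∀ v ∈ V, v ∈ Set.extremePoints ℝ (convexHull ℝ (V : Set E))) {x y : E}
    (f : Module.Dual ℝ E) (hxy : f y = f x) (hf : ∃ w ∈ V, f x < f w) :
    ∃ t, ∀ w ∈ V, w ≠ x → w ≠ y → f x ≤ f w →
      Relation.ReflTransGen (AdjAvoiding (convexHull ℝ (V : Set E)) x y) w t := by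
  classical
  set U := V.filter fun w => f x < f w with hU
  obtain ⟨c, hcD, hcN⟩ := exists_dual_pos_and_ne_zero f
    (U.image (fun w => w - x) ∪ U.image (fun w => w - y))
    (((V ×ˢ V).filter fun p => p.1 ≠ p.2).image fun p => p.1 - p.2)
    (by
      intro d hd
      rcases Finset.mem_union.1 hd with hd | hd <;>
      · obtain ⟨w, hw, rfl⟩ := Finset.mem_image.1 hd
        rw [map_sub, sub_pos]
        have := (Finset.mem_filter.1 hw).2
        linarith)
    (by
      intro n hn
      obtain ⟨p, hp, rfl⟩ := Finset.mem_image.1 hn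
      exact sub_ne_zero.2 (Finset.mem_filter.1 hp).2)
  have hinj : ∀ u ∈ V, ∀ w ∈ V, c u = c w → u = w := by
    intro u hu w hw h
    by_contra hne
    refine hcN (u - w) (Finset.mem_image.2 ⟨(u, w), Finset.mem_filter.2
      ⟨Finset.mem_product.2 ⟨hu, hw⟩, hne⟩, rfl⟩) ?_
    rw [map_sub, h, sub_self]
  have hcU : ∀ w ∈ V, f x < f w → c x < c w ∧ c y < c w := by
    intro w hw h
    have hwU : w ∈ U := Finset.mem_filter.2 ⟨hw, h⟩
    have h1 := hcD _ (Finset.mem_union_left _ (Finset.mem_image_of_mem (fun w => w - x) hwU))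
    have h2 := hcD _ (Finset.mem_union_right _ (Finset.mem_image_of_mem (fun w => w - y) hwU))
    simp only [map_sub] at h1 h2
    exact ⟨by linarith, by linarith⟩
  obtain ⟨w₀, hw₀, hfw₀⟩ := hf
  obtain ⟨t, ht, hmax⟩ := Finset.exists_max_image V c ⟨w₀, hw₀⟩
  have hne : ∀ w, c x < c w ∧ c y < c w → w ≠ x ∧ w ≠ y := by
    rintro w ⟨h1, h2⟩
    exact ⟨fun h => by rw [h] at h1; exact lt_irrefl _ h1,
      fun h => by rw [h] at h2; exact lt_irrefl _ h2⟩
  have hup : ∀ w ∈ V, c x < c w ∧ c y < c w →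
      Relation.ReflTransGen (AdjAvoiding (convexHull ℝ (V : Set E)) x y) w t := by
    by_contra! hbad
    obtain ⟨w₁, hw₁, hcw₁, hbad₁⟩ := hbad
    obtain ⟨w, hw, hwmax⟩ := Finset.exists_max_image (V.filter fun w => (c x < c w ∧ c y < c w) ∧
      ¬ Relation.ReflTransGen (AdjAvoiding (convexHull ℝ (V : Set E)) x y) w t) c
      ⟨w₁, Finset.mem_filter.2 ⟨hw₁, hcw₁, hbad₁⟩⟩
    obtain ⟨hwV, hcw, hbad⟩ := Finset.mem_filter.1 hw
    by_cases hwt : w = t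
    · exact hbad (hwt ▸ .refl)
    have hlt : c w < c t := lt_of_le_of_ne (hmax w hwV) fun h => hwt (hinj w hwV t ht h)
    obtain ⟨w', hw', hadj, hlt'⟩ := exists_polyAdj_lt hV hwV c ⟨t, ht, hlt⟩
    have hcw' : c x < c w' ∧ c y < c w' := ⟨hcw.1.trans hlt', hcw.2.trans hlt'⟩
    by_cases hgood : Relation.ReflTransGen (AdjAvoiding (convexHull ℝ (V : Set E)) x y) w' t
    · exact hbad (.head ⟨hadj, hne w hcw, hne w' hcw'⟩ hgood)
    · exact absurd (hwmax w' (Finset.mem_filter.2 ⟨hw', hcw', hgood⟩)) hlt'.not_ge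
  refine ⟨t, fun w hw hwx hwy hfw => ?_⟩
  rcases hfw.lt_or_eq with h | h
  · exact hup w hw (hcU w hw h)
  · obtain ⟨w', hw', hadj, hlt'⟩ := exists_polyAdj_lt hV hw f ⟨w₀, hw₀, h ▸ hfw₀⟩
    have hcz := hcU w' hw' (h ▸ hlt')
    exact .head ⟨hadj, ⟨hwx, hwy⟩, hne w' hcz⟩ (hup w' hw' hcz)

/-- Balinski's theorem in dimension three: deleting two vertices leaves the graph connected. -/
theorem reflTransGen_adjAvoiding [FiniteDimensional ℝ E] (hE : Module.finrank ℝ E = 3)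
    (hV : ∀ v ∈ V, v ∈ Set.extremePoints ℝ (convexHull ℝ (V : Set E)))
    (hspan : affineSpan ℝ (V : Set E) = ⊤) {x y a b : E} (ha : a ∈ V) (hb : b ∈ V)
    (hax : a ≠ x) (hay : a ≠ y) (hbx : b ≠ x) (hby : b ≠ y) :
    Relation.ReflTransGen (AdjAvoiding (convexHull ℝ (V : Set E)) x y) a b := by
  classical
  have hlt : Submodule.span ℝ (({y - x, a - x} : Finset E) : Set E) < ⊤ := by
    refine lt_top_iff_ne_top.2 fun h => ?_
    have h1 := finrank_span_finset_le_card (R := ℝ) ({y - x, a - x} : Finset E)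
    rw [Set.finrank, h, finrank_top, hE] at h1
    have h2 := Finset.card_le_two (a := y - x) (b := a - x)
    omega
  obtain ⟨f, hf0, hf⟩ := Submodule.exists_le_ker_of_lt_top _ hlt
  have hfy : f y = f x := by
    have : y - x ∈ LinearMap.ker f := hf (Submodule.subset_span (by simp))
    rwa [LinearMap.mem_ker, map_sub, sub_eq_zero] at this
  have hfa : f a = f x := by
    have : a - x ∈ LinearMap.ker f := hf (Submodule.subset_span (by simp))
    rwa [LinearMap.mem_ker, map_sub, sub_eq_zero] at this
  have hdown : (∃ w ∈ V, f w < f x) → ∃ t, ∀ w ∈ V, w ≠ x → w ≠ y → f w ≤ f x →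
      Relation.ReflTransGen (AdjAvoiding (convexHull ℝ (V : Set E)) x y) w t := by
    rintro ⟨w, hw, h⟩
    obtain ⟨t, ht⟩ := exists_forall_reflTransGen (x := x) (y := y) hV (-f) (by simp [hfy])
      ⟨w, hw, by simpa using h⟩
    exact ⟨t, fun w hw h1 h2 h3 => ht w hw h1 h2 (by simpa using h3)⟩
  by_cases hup : ∃ w ∈ V, f x < f w
  · obtain ⟨t, ht⟩ := exists_forall_reflTransGen (x := x) (y := y) hV f hfy hup
    rcases le_or_gt (f x) (f b) with h | h
    · exact (ht a ha hax hay hfa.ge).trans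
        (reflTransGen_adjAvoiding_symm (ht b hb hbx hby h))
    · obtain ⟨t, ht⟩ := hdown ⟨b, hb, h⟩
      exact (ht a ha hax hay hfa.le).trans
        (reflTransGen_adjAvoiding_symm (ht b hb hbx hby h.le))
  · push Not at hup
    by_cases hdn : ∃ w ∈ V, f w < f x
    · obtain ⟨t, ht⟩ := hdown hdn
      exact (ht a ha hax hay hfa.le).trans
        (reflTransGen_adjAvoiding_symm (ht b hb hbx hby (hup b hb)))
    · push Not at hdn
      exfalso
      apply hf0
      ext z
      have hz : z + a ∈ affineSpan ℝ (V : Set E) := hspan ▸ AffineSubspace.mem_top ℝ E _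
      have hsub : affineSpan ℝ (V : Set E) ≤ AffineSubspace.mk' a (LinearMap.ker f) := by
        rw [affineSpan_le]
        intro w hw
        rw [SetLike.mem_coe, AffineSubspace.mem_mk', vsub_eq_sub, LinearMap.mem_ker, map_sub, hfa,
          (hup w hw).antisymm (hdn w hw), sub_self]
      have := hsub hz
      rw [AffineSubspace.mem_mk', vsub_eq_sub, add_sub_cancel_right, LinearMap.mem_ker] at this
      simpa using this

end Graph

section Layers

variable {E : Type*} [NormedAddCommGroup E] [NormedSpace ℝ E] {V : Finset E}

theorem HasPathOfLength.snoc {P : Set E} {a u w : E} {L : ℕ} (h : HasPathOfLength P a u L)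
    (huw : PolyAdj P u w) : HasPathOfLength P a w (L + 1) := by
  obtain ⟨f, h0, hL, hf⟩ := h
  refine ⟨fun i => if i ≤ L then f i else w, by simpa using h0, by simp, fun i hi => ?_⟩
  rcases Nat.lt_succ_iff_lt_or_eq.1 hi with h | rfl
  · simpa [h.le, Nat.succ_le_of_lt h] using hf i h
  · simpa [hL] using huw

/-- As long as the ball of radius `i` around `a` misses some vertex, each distance layer up to `i`
has at least three elements. -/
theorem exists_path_of_card_lt [FiniteDimensional ℝ E] (hE : Module.finrank ℝ E = 3)
    (hV : ∀ v ∈ V, v ∈ Set.extremePoints ℝ (convexHull ℝ (V : Set E)))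
    (hspan : affineSpan ℝ (V : Set E) = ⊤) {a b : E} (ha : a ∈ V) (hb : b ∈ V) {N : ℕ}
    (hN : V.card < 3 * N + 2) :
    ∃ L ≤ N, HasPathOfLength (convexHull ℝ (V : Set E)) a b L := by
  classical
  by_contra hcon
  set B : ℕ → Finset E := fun i =>
    V.filter fun v => ∃ L ≤ i, HasPathOfLength (convexHull ℝ (V : Set E)) a v L with hB
  have hmono : ∀ i, B i ⊆ B (i + 1) := by
    intro i v hv
    obtain ⟨hv, L, hL, h⟩ := Finset.mem_filter.1 hv
    exact Finset.mem_filter.2 ⟨hv, L, hL.trans i.le_succ, h⟩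
  have haB : ∀ i, a ∈ B i := fun i =>
    Finset.mem_filter.2 ⟨ha, 0, i.zero_le, fun _ => a, rfl, rfl, by simp⟩
  have hbB : ∀ i ≤ N, b ∉ B i := by
    intro i hi hbi
    obtain ⟨-, L, hL, h⟩ := Finset.mem_filter.1 hbi
    exact hcon ⟨L, hL.trans hi, h⟩
  have hstep : ∀ i, i + 1 ≤ N → (B i).card + 3 ≤ (B (i + 1)).card := by
    intro i hi
    by_contra hlt
    have hcard := Finset.card_sdiff_add_card_eq_card (hmono i)
    have h2 : (B (i + 1) \ B i).card ≤ 2 := by omega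
    obtain ⟨x, y, hxy, hax, hay, hbx, hby⟩ : ∃ x y : E, (∀ z ∈ B (i + 1) \ B i, z = x ∨ z = y) ∧
        a ≠ x ∧ a ≠ y ∧ b ≠ x ∧ b ≠ y := by
      have hne : ∀ z ∈ B (i + 1) \ B i, a ≠ z ∧ b ≠ z := by
        intro z hz
        obtain ⟨h1, h2⟩ := Finset.mem_sdiff.1 hz
        exact ⟨fun h => h2 (h ▸ haB i), fun h => hbB (i + 1) hi (h ▸ h1)⟩
      interval_cases hc : (B (i + 1) \ B i).card
      · have : Nontrivial E := Module.nontrivial_of_finrank_pos (R := ℝ) (by omega)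
        have : Infinite E := Module.Free.infinite ℝ E
        obtain ⟨z, hz⟩ := Infinite.exists_notMem_finset {a, b}
        simp only [Finset.mem_insert, Finset.mem_singleton, not_or] at hz
        refine ⟨z, z, ?_, Ne.symm hz.1, Ne.symm hz.1, Ne.symm hz.2, Ne.symm hz.2⟩
        rw [Finset.card_eq_zero.1 hc]
        simp
      · obtain ⟨z, hz⟩ := Finset.card_eq_one.1 hc
        rw [hz] at hne ⊢
        have := hne z (by simp)
        exact ⟨z, z, by simp, this.1, this.1, this.2, this.2⟩
      · obtain ⟨z, z', -, hz⟩ := Finset.card_eq_two.1 hc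
        rw [hz] at hne ⊢
        have h1 := hne z (by simp)
        have h2 := hne z' (by simp)
        exact ⟨z, z', by simp, h1.1, h2.1, h1.2, h2.2⟩
    have hreach : ∀ w, Relation.ReflTransGen (AdjAvoiding (convexHull ℝ (V : Set E)) x y) a w →
        w ∈ B i := by
      intro w haw
      induction haw with
      | refl => exact haB i
      | @tail u w _ huw ih =>
        obtain ⟨-, L, hL, hpath⟩ := Finset.mem_filter.1 ih
        have hwV : w ∈ V := by
          exact_mod_cast extremePoints_convexHull_subset huw.1.2.2.1
        have hw : w ∈ B (i + 1) :=
          Finset.mem_filter.2 ⟨hwV, L + 1, by omega, hpath.snoc huw.1⟩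
        by_contra hwi
        rcases hxy w (Finset.mem_sdiff.2 ⟨hw, hwi⟩) with h | h
        · exact huw.2.2.1 h
        · exact huw.2.2.2 h
    exact hbB i (by omega) (hreach b
      (reflTransGen_adjAvoiding hE hV hspan ha hb hax hay hbx hby))
  have hgrow : ∀ i ≤ N, 3 * i + 1 ≤ (B i).card := by
    intro i
    induction i with
    | zero => exact fun _ => Finset.card_pos.2 ⟨a, haB 0⟩
    | succ i ih =>
      intro hi
      have := ih (by omega)
      have := hstep i hi
      omega
  have h1 := hgrow N le_rfl
  have h2 : (B N).card < V.card :=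
    Finset.card_lt_card ⟨Finset.filter_subset _ _, fun h => hbB N le_rfl (h hb)⟩
  omega

end Layers

section Facets

variable {E : Type*} [NormedAddCommGroup E] [NormedSpace ℝ E] {V : Finset E}

theorem mem_vectorSpan_of_apply_eq {F : Set E} {f : Module.Dual ℝ E} {c : ℝ}
    (hF : ∀ x ∈ F, f x = c) : vectorSpan ℝ F ≤ LinearMap.ker f := by
  rw [vectorSpan, Submodule.span_le]
  rintro _ ⟨x, hx, y, hy, rfl⟩
  simp [hF x hx, hF y hy]

/-- For every direction `u` there is a facet through the vertex `v` transversal to `u`. -/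
theorem exists_facet_notMem_vectorSpan [FiniteDimensional ℝ E] (hE : Module.finrank ℝ E = 3)
    (hV : ∀ v ∈ V, v ∈ Set.extremePoints ℝ (convexHull ℝ (V : Set E)))
    (hspan : affineSpan ℝ (V : Set E) = ⊤) {v : E} (hv : v ∈ V) {u : E} (hu : u ≠ 0) :
    ∃ F : Set E, IsFace (convexHull ℝ (V : Set E)) F ∧ v ∈ F ∧
      Module.finrank ℝ (vectorSpan ℝ F) = 2 ∧ u ∉ vectorSpan ℝ F := by
  classical
  wlog hpos : ∃ g : Module.Dual ℝ E, (∀ w ∈ V, g w ≤ g v) ∧ 0 < g u generalizing u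
  · obtain ⟨g₀, hg₀⟩ := exists_dual_exposing hV hv
    obtain ⟨g, hgD, hgN⟩ := exists_dual_pos_and_ne_zero g₀ ((V.erase v).image fun w => v - w) {u}
      (by
        intro d hd
        obtain ⟨w, hw, rfl⟩ := Finset.mem_image.1 hd
        rw [map_sub, sub_pos]
        exact hg₀ w (Finset.mem_of_mem_erase hw) (Finset.ne_of_mem_erase hw))
      (by simpa using hu)
    have hg : ∀ w ∈ V, g w ≤ g v := by
      intro w hw
      by_cases h : w = v
      · rw [h]
      · have := hgD _ (Finset.mem_image_of_mem _ (Finset.mem_erase.2 ⟨h, hw⟩))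
        rw [map_sub, sub_pos] at this
        exact this.le
    have hgu : g u ≠ 0 := hgN u (by simp)
    rcases hgu.lt_or_gt with h | h
    · obtain ⟨F, h1, h2, h3, h4⟩ := this (u := -u) (neg_ne_zero.2 hu) ⟨g, hg, by simpa using h⟩
      exact ⟨F, h1, h2, h3, fun h => h4 (neg_mem h)⟩
    · exact absurd ⟨g, hg, h⟩ hpos
  let A : Set (Module.Dual ℝ E) := {g | (∀ w ∈ V, g w ≤ g v) ∧ 0 < g u}
  let T : Module.Dual ℝ E → Finset E := fun g => V.filter fun w => g w = g v
  obtain ⟨g, ⟨hgV, hgu⟩, hmax⟩ : ∃ g ∈ A, ∀ g' ∈ A, (T g').card ≤ (T g).card := by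
    obtain ⟨g, hg⟩ := hpos
    have hfin : ((fun g => (T g).card) '' A).Finite := by
      refine (Set.finite_Iic V.card).subset ?_
      rintro _ ⟨g, -, rfl⟩
      exact Finset.card_le_card (Finset.filter_subset _ _)
    obtain ⟨_, ⟨g', hg', rfl⟩, h⟩ := Set.exists_max_image _ id hfin ⟨_, ⟨g, hg, rfl⟩⟩
    exact ⟨g', hg', fun g'' h'' => h _ ⟨g'', h'', rfl⟩⟩
  have hface := isFace_convexHull_setOf_eq g hgV
  set F := {x ∈ convexHull ℝ (V : Set E) | g x = g v} with hF
  have hvF : v ∈ F := ⟨(hV v hv).1, rfl⟩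
  have hker : vectorSpan ℝ F ≤ LinearMap.ker g := mem_vectorSpan_of_apply_eq fun x hx => hx.2
  have hg0 : g ≠ 0 := by rintro rfl; simp at hgu
  have hfk := Module.Dual.finrank_ker_add_one_of_ne_zero hg0
  have hle := Submodule.finrank_mono hker
  have huF : u ∉ vectorSpan ℝ F := fun h => hgu.ne' (hker h)
  have htop : vectorSpan ℝ F ⊔ Submodule.span ℝ {u} = ⊤ := by
    by_contra hne
    obtain ⟨b, hb0, hb⟩ := Submodule.exists_le_ker_of_lt_top _ (lt_top_iff_ne_top.2 hne)
    have hbu : b u = 0 := hb (Submodule.mem_sup_right (Submodule.mem_span_singleton_self u))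
    have hbF : ∀ x ∈ F, b x = b v := by
      intro x hx
      have : x - v ∈ LinearMap.ker b := hb (Submodule.mem_sup_left (vsub_mem_vectorSpan ℝ hx hvF))
      rwa [LinearMap.mem_ker, map_sub, sub_eq_zero] at this
    clear hb
    wlog hup : ∃ w ∈ V, b v < b w generalizing b
    · refine this (-b) (neg_ne_zero.2 hb0) (by simp [hbu]) (by simpa using hbF) ?_
      by_contra! hcon
      push Not at hup
      apply hb0
      ext z
      have hz : z + v ∈ affineSpan ℝ (V : Set E) := hspan ▸ AffineSubspace.mem_top ℝ E _
      have hsub : affineSpan ℝ (V : Set E) ≤ AffineSubspace.mk' v (LinearMap.ker b) := by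
        rw [affineSpan_le]
        intro w hw
        have h1 := hup w hw
        have h2 := hcon w hw
        simp only [LinearMap.neg_apply, neg_le_neg_iff] at h2
        rw [SetLike.mem_coe, AffineSubspace.mem_mk', vsub_eq_sub, LinearMap.mem_ker, map_sub,
          h1.antisymm h2, sub_self]
      have := hsub hz
      rw [AffineSubspace.mem_mk', vsub_eq_sub, add_sub_cancel_right, LinearMap.mem_ker] at this
      simpa using this
    obtain ⟨w₀, hw₀, hbw₀⟩ := hup
    obtain ⟨w, hw, hmin⟩ := Finset.exists_min_image (V.filter fun w => b v < b w)
      (fun w => (g v - g w) / (b w - b v)) ⟨w₀, Finset.mem_filter.2 ⟨hw₀, hbw₀⟩⟩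
    obtain ⟨hwV, hbw⟩ := Finset.mem_filter.1 hw
    set t := (g v - g w) / (b w - b v) with ht
    have ht0 : 0 ≤ t := div_nonneg (sub_nonneg.2 (hgV w hwV)) (sub_pos.2 hbw).le
    have htw : g v - g w = t * (b w - b v) := by
      rw [ht, div_mul_cancel₀ _ (sub_pos.2 hbw).ne']
    have hA : g + t • b ∈ A := by
      refine ⟨fun x hx => ?_, by simpa [hbu] using hgu⟩
      simp only [LinearMap.add_apply, LinearMap.smul_apply, smul_eq_mul]
      rcases lt_or_ge (b v) (b x) with h | h
      · have := (le_div_iff₀ (sub_pos.2 h)).1 (hmin x (Finset.mem_filter.2 ⟨hx, h⟩))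
        linarith
      · have h1 := mul_le_mul_of_nonneg_left h ht0
        have h2 := hgV x hx
        linarith
    refine (hmax _ hA).not_gt (Finset.card_lt_card ⟨fun x hx => ?_, fun hsub => ?_⟩)
    · obtain ⟨hxV, hgx⟩ := Finset.mem_filter.1 hx
      refine Finset.mem_filter.2 ⟨hxV, ?_⟩
      have := hbF x ⟨(hV x hxV).1, hgx⟩
      simp only [LinearMap.add_apply, LinearMap.smul_apply, this, hgx]
    · have hwT : w ∈ T g := by
        refine hsub (Finset.mem_filter.2 ⟨hwV, ?_⟩)
        simp only [LinearMap.add_apply, LinearMap.smul_apply, smul_eq_mul]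
        linarith
      have := hbF w ⟨(hV w hwV).1, (Finset.mem_filter.1 hwT).2⟩
      exact hbw.ne' this
  refine ⟨F, hface, hvF, ?_, huF⟩
  have h1 := Submodule.finrank_add_le_finrank_add_finrank (vectorSpan ℝ F) (Submodule.span ℝ {u})
  rw [htop, finrank_top, hE] at h1
  have h2 := finrank_span_singleton (K := ℝ) hu
  omega

end Facets

section FacetCount

variable {E : Type*} [NormedAddCommGroup E] [NormedSpace ℝ E] {V : Finset E}

theorem IsFace.inter {P F G : Set E} (hF : IsFace P F) (hG : IsFace P G) : IsFace P (F ∩ G) :=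
  ⟨hF.1.inter hG.1, hF.2.inter hG.2⟩

/-- A two-dimensional face is determined by three of its points in general position. -/
theorem IsFace.subset_of_linearIndependent [FiniteDimensional ℝ E] {F G : Set E}
    (hF : IsFace (convexHull ℝ (V : Set E)) F) (hG : IsFace (convexHull ℝ (V : Set E)) G)
    (hF2 : Module.finrank ℝ (vectorSpan ℝ F) = 2) (hG2 : Module.finrank ℝ (vectorSpan ℝ G) = 2)
    {v p q : E} (hv : v ∈ F ∩ G) (hp : p ∈ F ∩ G) (hq : q ∈ F ∩ G)
    (hli : LinearIndependent ℝ ![p - v, q - v]) : F ⊆ G := by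
  have key : ∀ H : Set E, Module.finrank ℝ (vectorSpan ℝ H) = 2 → v ∈ H → p ∈ H → q ∈ H →
      Submodule.span ℝ (Set.range ![p - v, q - v]) = vectorSpan ℝ H := by
    intro H hH hv hp hq
    refine Submodule.eq_of_le_of_finrank_eq (Submodule.span_le.2 ?_) ?_
    · rintro _ ⟨i, rfl⟩
      fin_cases i
      · exact vsub_mem_vectorSpan ℝ hp hv
      · exact vsub_mem_vectorSpan ℝ hq hv
    · rw [finrank_span_eq_card hli, hH, Fintype.card_fin]
  intro x hx
  refine hG.mem_of_mem_affineSpan (hF.2.subset hx) ?_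
  have h1 : x - v ∈ vectorSpan ℝ G := by
    rw [← key G hG2 hv.2 hp.2 hq.2, key F hF2 hv.1 hp.1 hq.1]
    exact vsub_mem_vectorSpan ℝ hx hv.1
  rw [← direction_affineSpan] at h1
  simpa using AffineSubspace.vadd_mem_of_mem_direction h1 (mem_affineSpan ℝ hv.2)

/-- Two distinct facets through a vertex share no further point on its level. -/
theorem IsFace.eq_of_apply_eq [FiniteDimensional ℝ E] {F G : Set E}
    (hF : IsFace (convexHull ℝ (V : Set E)) F) (hG : IsFace (convexHull ℝ (V : Set E)) G)
    (hF2 : Module.finrank ℝ (vectorSpan ℝ F) = 2) (hG2 : Module.finrank ℝ (vectorSpan ℝ G) = 2)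
    (hFG : F ≠ G) {v p : E} (hvV : v ∈ V) (hv : v ∈ F ∩ G) (hp : p ∈ F ∩ G)
    {c : Module.Dual ℝ E} (hc : Set.InjOn c V) (hpv : c p = c v) : p = v := by
  by_contra hne
  obtain ⟨w, ⟨hwV, hw⟩, hwv⟩ : ∃ w ∈ (V : Set E) ∩ (F ∩ G), w ≠ v := by
    by_contra! h
    have := (hF.inter hG).2.subset_convexHull_inter hp
    rw [show (V : Set E) ∩ (F ∩ G) = {v} from
      Set.Subset.antisymm (fun x hx => h x hx) (by simpa using ⟨hvV, hv⟩), convexHull_singleton]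
      at this
    exact hne this
  have hli : LinearIndependent ℝ ![p - v, w - v] := by
    rw [LinearIndependent.pair_iff]
    intro s t hst
    have h1 := congrArg c hst
    simp only [map_add, map_smul, map_sub, hpv, sub_self, zero_add, map_zero,
      smul_eq_mul, mul_zero, mul_eq_zero, sub_eq_zero] at h1
    have ht : t = 0 := h1.resolve_right fun h => hwv (hc hwV hvV h)
    rw [ht, zero_smul, add_zero, smul_eq_zero, sub_eq_zero] at hst
    exact ⟨hst.resolve_right hne, ht⟩
  exact hFG ((hF.subset_of_linearIndependent hG hF2 hG2 hv hp hw hli).antisymm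
    (hG.subset_of_linearIndependent hF hG2 hF2 hv.symm hp.symm hw.symm hli))

theorem exists_three_facets [FiniteDimensional ℝ E] (hE : Module.finrank ℝ E = 3)
    (hV : ∀ v ∈ V, v ∈ Set.extremePoints ℝ (convexHull ℝ (V : Set E)))
    (hspan : affineSpan ℝ (V : Set E) = ⊤) {v : E} (hv : v ∈ V) :
    ∃ F : Fin 3 → Set E, Function.Injective F ∧ ∀ i, IsFace (convexHull ℝ (V : Set E)) (F i) ∧
      v ∈ F i ∧ Module.finrank ℝ (vectorSpan ℝ (F i)) = 2 := by
  have hex : ∀ W : Submodule ℝ E, 0 < Module.finrank ℝ W → ∃ u ∈ W, u ≠ 0 := fun W hW =>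
    W.exists_mem_ne_zero_of_ne_bot fun h => by rw [h, finrank_bot] at hW; exact hW.false
  obtain ⟨u, -, hu⟩ := hex ⊤ (by rw [finrank_top]; omega)
  obtain ⟨F, hF, hvF, hF2, -⟩ := exists_facet_notMem_vectorSpan hE hV hspan hv hu
  obtain ⟨u, huF, hu⟩ := hex (vectorSpan ℝ F) (by omega)
  obtain ⟨G, hG, hvG, hG2, huG⟩ := exists_facet_notMem_vectorSpan hE hV hspan hv hu
  have hFG : F ≠ G := fun h => huG (h ▸ huF)
  obtain ⟨u, ⟨huF, huG⟩, hu⟩ := hex (vectorSpan ℝ F ⊓ vectorSpan ℝ G) (by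
    have h1 := Submodule.finrank_sup_add_finrank_inf_eq (vectorSpan ℝ F) (vectorSpan ℝ G)
    have h2 := Submodule.finrank_le (vectorSpan ℝ F ⊔ vectorSpan ℝ G)
    omega)
  obtain ⟨H, hH, hvH, hH2, huH⟩ := exists_facet_notMem_vectorSpan hE hV hspan hv hu
  have hFH : F ≠ H := fun h => huH (h ▸ huF)
  have hGH : G ≠ H := fun h => huH (h ▸ huG)
  refine ⟨![F, G, H], ?_, ?_⟩
  · intro i j hij
    fin_cases i <;> fin_cases j <;> simp_all
  · intro i
    fin_cases i
    · exact ⟨hF, hvF, hF2⟩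
    · exact ⟨hG, hvG, hG2⟩
    · exact ⟨hH, hvH, hH2⟩

theorem lt_of_exposing {v p : E} {g : Module.Dual ℝ E} (hv : v ∈ V)
    (hg : ∀ w ∈ V, w ≠ v → g w < g v)
    (hp : p ∈ convexHull ℝ (V : Set E)) (hpv : p ≠ v) : g p < g v := by
  have hle : ∀ w ∈ V, g w ≤ g v := fun w hw => by
    by_cases h : w = v
    · rw [h]
    · exact (hg w hw h).le
  refine lt_of_le_of_ne (apply_le_of_mem_convexHull g hle p hp) fun h => hpv ?_
  have := (isFace_convexHull_setOf_eq g hle).2.subset_convexHull_inter ⟨hp, h⟩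
  rw [show (V : Set E) ∩ {x ∈ convexHull ℝ (V : Set E) | g x = g v} = {v} from
    Set.Subset.antisymm (fun x hx => by_contra fun hne => (hg x hx.1 hne).ne hx.2.2)
      (by simpa using ⟨hv, subset_convexHull ℝ _ hv⟩), convexHull_singleton] at this
  exact this

theorem eq_zero_of_relation [FiniteDimensional ℝ E]
    (hV : ∀ v ∈ V, v ∈ Set.extremePoints ℝ (convexHull ℝ (V : Set E))) {v : E} (hv : v ∈ V)
    {F : Fin 3 → Set E} (hF : Function.Injective F)
    (hface : ∀ i, IsFace (convexHull ℝ (V : Set E)) (F i) ∧ v ∈ F i ∧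
      Module.finrank ℝ (vectorSpan ℝ (F i)) = 2)
    {c : Module.Dual ℝ E} (hc : Set.InjOn c V) {p : Fin 3 → E} (hp : ∀ i, p i ∈ F i)
    (hpv : ∀ i, p i ≠ v) (hcp : ∀ i, c (p i) = c v) {i j k : Fin 3} (hij : i ≠ j) (hik : i ≠ k)
    {x y z : ℝ} (hy : 0 ≤ y) (hz : 0 ≤ z)
    (h : x • (p i - v) + y • (p j - v) + z • (p k - v) = 0) : x = 0 ∧ y = 0 ∧ z = 0 := by
  obtain ⟨g, hg⟩ := exists_dual_exposing hV hv
  have hgp : ∀ l, g (p l - v) < 0 := fun l => by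
    rw [map_sub, sub_neg]
    exact lt_of_exposing hv hg ((hface l).1.2.subset (hp l)) (hpv l)
  have hgh := congrArg g h
  simp only [map_add, map_smul, smul_eq_mul, map_zero] at hgh
  have hi := hgp i
  have hj := hgp j
  have hk := hgp k
  rcases le_or_gt 0 x with hx | hx
  · have h1 := mul_nonpos_of_nonneg_of_nonpos hx hi.le
    have h2 := mul_nonpos_of_nonneg_of_nonpos hy hj.le
    have h3 := mul_nonpos_of_nonneg_of_nonpos hz hk.le
    refine ⟨?_, ?_, ?_⟩
    · exact (mul_eq_zero.1 (by linarith : x * g (p i - v) = 0)).resolve_right hi.ne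
    · exact (mul_eq_zero.1 (by linarith : y * g (p j - v) = 0)).resolve_right hj.ne
    · exact (mul_eq_zero.1 (by linarith : z * g (p k - v) = 0)).resolve_right hk.ne
  · exfalso
    -- points of `P` on the rays towards `p j` and `p k` with midpoint on the ray towards `p i`
    set s : ℝ := (2 * (y + z - x))⁻¹ with hs
    have hpos : 0 < 2 * (y + z - x) := by linarith
    have hs0 : 0 < s := inv_pos.2 hpos
    have hs1 : s * (2 * (y + z - x)) = 1 := inv_mul_cancel₀ hpos.ne'
    have hmem : ∀ l, ∀ t : ℝ, 0 ≤ t → t ≤ 1 → v + t • (p l - v) ∈ F l := fun l t h0 h1 =>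
      (hface l).1.1.add_smul_sub_mem (hface l).2.1 (hp l) ⟨h0, h1⟩
    have hq : v + (-(s * x)) • (p i - v) ∈ F i := hmem i _ (by nlinarith) (by nlinarith)
    have hqj := hmem j (2 * s * y) (by positivity) (by nlinarith)
    have hqk := hmem k (2 * s * z) (by positivity) (by nlinarith)
    have hseg : v + (-(s * x)) • (p i - v) ∈
        openSegment ℝ (v + (2 * s * y) • (p j - v)) (v + (2 * s * z) • (p k - v)) := by
      refine ⟨1 / 2, 1 / 2, by norm_num, by norm_num, by norm_num, ?_⟩
      have h2 : x • (p i - v) = -(y • (p j - v)) - z • (p k - v) := by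
        rw [← sub_eq_zero, ← h]; abel
      rw [neg_smul, mul_smul s x, h2]
      module
    have hPj := (hface j).1.2.subset hqj
    have hPk := (hface k).1.2.subset hqk
    have main : ∀ l, i ≠ l → ∀ y : ℝ, 0 < y → v + (2 * s * y) • (p l - v) ∈ F i →
        v + (2 * s * y) • (p l - v) ∈ F l → False := by
      intro l hil y hy h1 h2
      have := (hface i).1.eq_of_apply_eq (hface l).1 (hface i).2.2 (hface l).2.2 (hF.ne hil) hv
        ⟨(hface i).2.1, (hface l).2.1⟩ ⟨h1, h2⟩ hc (by simp [hcp])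
      rw [add_eq_left, smul_eq_zero, sub_eq_zero] at this
      rcases this with h | h
      · exact (by positivity : 2 * s * y ≠ 0) h
      · exact hpv l h
    rcases hy.lt_or_eq with hy' | rfl
    · exact main j hij y hy' ((hface i).1.2.left_mem_of_mem_openSegment hPj hPk hq hseg) hqj
    rcases hz.lt_or_eq with hz' | rfl
    · exact main k hik z hz' ((hface i).1.2.right_mem_of_mem_openSegment hPj hPk hq hseg) hqk
    · nlinarith

/-- Every vertex is the lowest or the highest point of one of any three facets through it. -/
theorem exists_facet_min_or_max [FiniteDimensional ℝ E] (hE : Module.finrank ℝ E = 3)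
    (hV : ∀ v ∈ V, v ∈ Set.extremePoints ℝ (convexHull ℝ (V : Set E))) {v : E} (hv : v ∈ V)
    {F : Fin 3 → Set E} (hF : Function.Injective F)
    (hface : ∀ i, IsFace (convexHull ℝ (V : Set E)) (F i) ∧ v ∈ F i ∧
      Module.finrank ℝ (vectorSpan ℝ (F i)) = 2)
    {c : Module.Dual ℝ E} (hc0 : c ≠ 0) (hc : Set.InjOn c V) :
    ∃ i, (∀ x ∈ F i, c v ≤ c x) ∨ ∀ x ∈ F i, c x ≤ c v := by
  by_contra! hcon
  have hex : ∀ i, ∃ p ∈ F i, p ≠ v ∧ c p = c v := by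
    intro i
    obtain ⟨⟨x, hx, hxv⟩, y, hy, hyv⟩ := hcon i
    set t : ℝ := (c v - c x) / (c y - c x) with ht
    have h0 : 0 < c y - c x := by linarith
    have ht0 : 0 < t := div_pos (by linarith) h0
    have ht1 : t < 1 := (div_lt_one h0).2 (by linarith)
    have hmem : x + t • (y - x) ∈ openSegment ℝ x y :=
      ⟨1 - t, t, by linarith, ht0, by ring, by module⟩
    refine ⟨x + t • (y - x), (hface i).1.1.openSegment_subset hx hy hmem, fun h => ?_, ?_⟩
    · rw [h] at hmem
      have := (hV v hv).2 ((hface i).1.2.subset hx) ((hface i).1.2.subset hy) hmem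
      rw [this] at hxv
      exact hxv.false
    · simp only [map_add, map_smul, map_sub, smul_eq_mul]
      rw [ht, div_mul_cancel₀ _ h0.ne']
      ring
  choose p hp hpv hcp using hex
  have hker : Module.finrank ℝ (LinearMap.ker c) = 2 := by
    have h1 := LinearMap.finrank_range_add_finrank_ker c
    have h2 : LinearMap.range c = ⊤ := LinearMap.range_eq_top.2 (LinearMap.surjective hc0)
    rw [h2, finrank_top, Module.finrank_self, hE] at h1
    omega
  have hdep : ¬ LinearIndependent ℝ fun i => (⟨p i - v, by simp [hcp i]⟩ : LinearMap.ker c) := by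
    intro h
    have := h.fintype_card_le_finrank
    rw [hker, Fintype.card_fin] at this
    omega
  obtain ⟨l, hl, hl0⟩ := Fintype.not_linearIndependent_iff.1 hdep
  have hl := congrArg Subtype.val hl
  simp only [Fin.sum_univ_three, Submodule.coe_add, Submodule.coe_smul, ZeroMemClass.coe_zero] at hl
  have key : ∀ i j k : Fin 3, i ≠ j → i ≠ k →
      l i • (p i - v) + l j • (p j - v) + l k • (p k - v) = 0 →
      ((0 ≤ l j ∧ 0 ≤ l k) ∨ (l j ≤ 0 ∧ l k ≤ 0)) → l i = 0 ∧ l j = 0 ∧ l k = 0 := by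
    rintro i j k hij hik h (⟨hj, hk⟩ | ⟨hj, hk⟩)
    · exact eq_zero_of_relation hV hv hF hface hc hp hpv hcp hij hik hj hk h
    · have := eq_zero_of_relation hV hv hF hface hc hp hpv hcp hij hik (x := -l i)
        (neg_nonneg.2 hj) (neg_nonneg.2 hk) (by
          rw [neg_smul, neg_smul, neg_smul, ← neg_add, ← neg_add, h, neg_zero])
      simpa using this
  have hall : l 0 = 0 ∧ l 1 = 0 ∧ l 2 = 0 := by
    have k0 := key 0 1 2 (by decide) (by decide) hl
    have k1 := key 1 0 2 (by decide) (by decide) (by rw [← hl]; abel)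
    have k2 := key 2 0 1 (by decide) (by decide) (by rw [← hl]; abel)
    rcases le_total 0 (l 0) with h0 | h0 <;> rcases le_total 0 (l 1) with h1 | h1 <;>
      rcases le_total 0 (l 2) with h2 | h2
    · exact k0 (.inl ⟨h1, h2⟩)
    · have := k2 (.inl ⟨h0, h1⟩)
      exact ⟨this.2.1, this.2.2, this.1⟩
    · have := k1 (.inl ⟨h0, h2⟩)
      exact ⟨this.2.1, this.1, this.2.2⟩
    · exact k0 (.inr ⟨h1, h2⟩)
    · exact k0 (.inl ⟨h1, h2⟩)
    · have := k1 (.inr ⟨h0, h2⟩)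
      exact ⟨this.2.1, this.1, this.2.2⟩
    · have := k2 (.inr ⟨h0, h1⟩)
      exact ⟨this.2.1, this.2.2, this.1⟩
    · exact k0 (.inr ⟨h1, h2⟩)
  obtain ⟨i, hi⟩ := hl0
  fin_cases i
  · exact hi hall.1
  · exact hi hall.2.1
  · exact hi hall.2.2

end FacetCount

section VertexCount

variable {E : Type*} [NormedAddCommGroup E] [NormedSpace ℝ E] [FiniteDimensional ℝ E]

theorem setDim_eq_three_iff (hE : Module.finrank ℝ E = 3) {T : Set E} (hT : T.Nonempty) :
    setDim T = 3 ↔ affineSpan ℝ T = ⊤ := by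
  rw [setDim, ← AffineSubspace.direction_eq_top_iff_of_nonempty ((affineSpan_nonempty ℝ).2 hT)]
  constructor
  · intro h
    exact Submodule.eq_top_of_finrank_eq (h.trans hE.symm)
  · intro h
    rw [h, finrank_top, hE]

omit [FiniteDimensional ℝ E] in
theorem isFacet_iff {P F : Set E} (hP : setDim P = 3) :
    IsFacet P F ↔ IsFace P F ∧ Module.finrank ℝ (vectorSpan ℝ F) = 2 := by
  rw [IsFacet, hP, setDim, direction_affineSpan]

/-- A 3-polytope with `n` facets has at most `2 n - 4` vertices. -/
theorem card_add_four_le {V : Finset E} (hE : Module.finrank ℝ E = 3)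
    (hV : ∀ v ∈ V, v ∈ Set.extremePoints ℝ (convexHull ℝ (V : Set E)))
    (hspan : affineSpan ℝ (V : Set E) = ⊤) :
    V.card + 4 ≤ 2 * numFacets (convexHull ℝ (V : Set E)) := by
  classical
  have hVne : V.Nonempty := by
    rw [← Finset.coe_nonempty, ← affineSpan_nonempty ℝ, hspan]
    exact ⟨0, trivial⟩
  have hPdim : setDim (convexHull ℝ (V : Set E)) = 3 := by
    rw [setDim_eq_three_iff hE (convexHull_nonempty_iff.2 hVne), affineSpan_convexHull, hspan]
  have hfin : {F : Set E | IsFacet (convexHull ℝ (V : Set E)) F}.Finite :=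
    (finite_setOf_isFace V).subset fun F hF => hF.1
  set Φ : Finset (Set E) := hfin.toFinset with hΦ
  have hmemΦ : ∀ F, F ∈ Φ ↔ IsFace (convexHull ℝ (V : Set E)) F ∧
      Module.finrank ℝ (vectorSpan ℝ F) = 2 := fun F => by
    rw [hΦ, Set.Finite.mem_toFinset]
    exact isFacet_iff hPdim
  have hcard : numFacets (convexHull ℝ (V : Set E)) = Φ.card :=
    Set.ncard_eq_toFinset_card _ hfin
  -- a linear form which is injective on the vertices
  obtain ⟨c, -, hcN⟩ := exists_dual_pos_and_ne_zero (0 : Module.Dual ℝ E) ∅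
    (((V ×ˢ V).filter fun p => p.1 ≠ p.2).image fun p => p.1 - p.2) (by simp) (by
      intro d hd
      obtain ⟨p, hp, rfl⟩ := Finset.mem_image.1 hd
      exact sub_ne_zero.2 (Finset.mem_filter.1 hp).2)
  have hc : Set.InjOn c V := by
    intro x hx y hy hxy
    by_contra hne
    refine hcN (x - y) (Finset.mem_image.2 ⟨(x, y), Finset.mem_filter.2
      ⟨Finset.mem_product.2 ⟨hx, hy⟩, hne⟩, rfl⟩) ?_
    rw [map_sub, hxy, sub_self]
  have hVtwo : ∃ x ∈ V, ∃ y ∈ V, x ≠ y := by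
    by_contra! h
    have : Nontrivial E := Module.nontrivial_of_finrank_pos (R := ℝ) (by omega)
    obtain ⟨v, hv⟩ := hVne
    have h1 : (V : Set E) = {v} := by
      ext x
      exact ⟨fun hx => h x hx v hv, fun hx => by rw [Set.mem_singleton_iff.1 hx]; exact hv⟩
    have h2 := direction_affineSpan ℝ (V : Set E)
    rw [hspan, h1, vectorSpan_singleton, AffineSubspace.direction_top] at h2
    exact top_ne_bot h2
  have hc0 : c ≠ 0 := by
    rintro rfl
    obtain ⟨x, hx, y, hy, hxy⟩ := hVtwo
    exact hxy (hc hx hy rfl)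
  obtain ⟨a, ha, hamin⟩ := V.exists_min_image c hVne
  obtain ⟨b, hb, hbmax⟩ := V.exists_max_image c hVne
  have hab : a ≠ b := by
    rintro rfl
    obtain ⟨x, hx, y, hy, hxy⟩ := hVtwo
    exact hxy (hc hx hy (((hbmax x hx).antisymm (hamin x hx)).trans
      ((hamin y hy).antisymm (hbmax y hy))))
  have hlow : ∀ x ∈ convexHull ℝ (V : Set E), c a ≤ c x := fun x hx => by
    have := apply_le_of_mem_convexHull (A := V) (-c) (c := -c a)
      (fun v hv => neg_le_neg (hamin v hv)) x hx
    exact neg_le_neg_iff.1 this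
  have hhigh : ∀ x ∈ convexHull ℝ (V : Set E), c x ≤ c b :=
    apply_le_of_mem_convexHull (A := V) c fun v hv => hbmax v hv
  -- the lowest and the highest vertex of a facet
  have hex : ∀ q : Set E × Bool, ∃ v ∈ V, ∀ w ∈ V, w ∈ q.1 →
      (q.2 = false → (∀ x ∈ q.1, c w ≤ c x) → w = v) ∧
      (q.2 = true → (∀ x ∈ q.1, c x ≤ c w) → w = v) := by
    rintro ⟨F, s⟩
    by_cases h : ∃ v ∈ V, v ∈ F ∧ (s = false → ∀ x ∈ F, c v ≤ c x) ∧
      (s = true → ∀ x ∈ F, c x ≤ c v)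
    · obtain ⟨v, hv, hvF, h1, h2⟩ := h
      exact ⟨v, hv, fun w hw hwF => ⟨fun hs h => hc hw hv ((h v hvF).antisymm (h1 hs w hwF)),
        fun hs h => hc hw hv ((h2 hs w hwF).antisymm (h v hvF))⟩⟩
    · refine ⟨a, ha, fun w hw hwF => ⟨fun hs h' => ?_, fun hs h' => ?_⟩⟩
      · exact (h ⟨w, hw, hwF, fun _ => h', fun ht => (Bool.false_ne_true (hs.symm.trans ht)).elim⟩).elim
      · exact (h ⟨w, hw, hwF, fun ht => (Bool.false_ne_true (ht.symm.trans hs)).elim, fun _ => h'⟩).elim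
  choose φ hφV hφ using hex
  set Q : Finset (Set E × Bool) := Φ ×ˢ Finset.univ with hQ
  have hfiber : ∀ v ∈ V, 1 + (if v = a then 2 else 0) + (if v = b then 2 else 0) ≤
      (Q.filter fun q => φ q = v).card := by
    intro v hv
    obtain ⟨F, hFinj, hF⟩ := exists_three_facets hE hV hspan hv
    have hmem : ∀ i s, F i ∈ Φ ∧ (F i, s) ∈ Q := fun i s => by
      have : F i ∈ Φ := (hmemΦ _).2 ⟨(hF i).1, (hF i).2.2⟩
      exact ⟨this, Finset.mem_product.2 ⟨this, Finset.mem_univ _⟩⟩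
    have hthree : ∀ s : Bool, (∀ i, φ (F i, s) = v) →
        3 ≤ (Q.filter fun q => φ q = v).card := by
      intro s h
      have h1 : (Finset.univ.image fun i => (F i, s)).card = 3 := by
        rw [Finset.card_image_of_injective _ fun i j hij => hFinj (congrArg Prod.fst hij)]
        simp
      rw [← h1]
      refine Finset.card_le_card fun q hq => ?_
      obtain ⟨i, -, rfl⟩ := Finset.mem_image.1 hq
      exact Finset.mem_filter.2 ⟨(hmem i s).2, h i⟩
    by_cases hva : v = a
    · have hvb : v ≠ b := hva ▸ hab
      simp only [hva, if_true, if_neg (hva ▸ hvb : a ≠ b)]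
      subst hva
      exact hthree false fun i =>
        (((hφ (F i, false) v hv (hF i).2.1).1 rfl) fun x hx => hlow x ((hF i).1.2.subset hx)).symm
    by_cases hvb : v = b
    · simp only [hvb, if_true, if_neg hab.symm]
      subst hvb
      exact hthree true fun i =>
        (((hφ (F i, true) v hv (hF i).2.1).2 rfl) fun x hx => hhigh x ((hF i).1.2.subset hx)).symm
    · rw [if_neg hva, if_neg hvb]
      refine Finset.card_pos.2 ?_
      obtain ⟨i, h | h⟩ := exists_facet_min_or_max hE hV hv hFinj hF hc0 hc
      · exact ⟨(F i, false), Finset.mem_filter.2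
          ⟨(hmem i _).2, (((hφ (F i, false) v hv (hF i).2.1).1 rfl) h).symm⟩⟩
      · exact ⟨(F i, true), Finset.mem_filter.2
          ⟨(hmem i _).2, (((hφ (F i, true) v hv (hF i).2.1).2 rfl) h).symm⟩⟩
  have h1 : Q.card = ∑ v ∈ V, (Q.filter fun q => φ q = v).card :=
    Finset.card_eq_sum_card_fiberwise fun q _ => hφV q
  have h2 := Finset.sum_le_sum hfiber
  rw [← h1, Finset.sum_add_distrib, Finset.sum_add_distrib, Finset.sum_ite_eq' V a,
    Finset.sum_ite_eq' V b, if_pos ha, if_pos hb, hQ, Finset.card_product] at h2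
  simp only [Finset.sum_const, smul_eq_mul, mul_one, Finset.card_univ, Fintype.card_bool] at h2
  rw [hcard]
  omega

omit [FiniteDimensional ℝ E] in
/-- A polytope is the convex hull of its finitely many extreme points. -/
theorem exists_finset_extremePoints (S : Finset E) :
    ∃ V : Finset E, (V : Set E) = Set.extremePoints ℝ (convexHull ℝ (S : Set E)) ∧
      convexHull ℝ (V : Set E) = convexHull ℝ (S : Set E) := by
  have hfin : (Set.extremePoints ℝ (convexHull ℝ (S : Set E))).Finite :=
    S.finite_toSet.subset extremePoints_convexHull_subset
  refine ⟨hfin.toFinset, hfin.coe_toFinset, ?_⟩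
  rw [hfin.coe_toFinset]
  have := closure_convexHull_extremePoints (S.finite_toSet.isCompact_convexHull ℝ)
    (convex_convexHull ℝ _)
  rwa [(hfin.isClosed_convexHull ℝ).closure_eq] at this

/-- Klee's upper bound. -/
theorem exists_path_le (hE : Module.finrank ℝ E = 3) (S : Finset E) (hS : S.Nonempty)
    (hdim : setDim (convexHull ℝ (S : Set E)) = 3) {a b : E}
    (ha : a ∈ Set.extremePoints ℝ (convexHull ℝ (S : Set E)))
    (hb : b ∈ Set.extremePoints ℝ (convexHull ℝ (S : Set E))) :
    ∃ L ≤ 2 * numFacets (convexHull ℝ (S : Set E)) / 3 - 1,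
      HasPathOfLength (convexHull ℝ (S : Set E)) a b L := by
  classical
  obtain ⟨V, hVext, hVS⟩ := exists_finset_extremePoints S
  rw [setDim_eq_three_iff hE (convexHull_nonempty_iff.2 hS), ← hVS, affineSpan_convexHull] at hdim
  rw [← hVS] at ha hb hVext ⊢
  rw [← hVext] at ha hb
  have hV : ∀ v ∈ V, v ∈ Set.extremePoints ℝ (convexHull ℝ (V : Set E)) := fun v hv => hVext ▸ hv
  have hcard := card_add_four_le hE hV hdim
  have h4 : 4 ≤ V.card := by
    have h1 := finrank_vectorSpan_image_finset_le ℝ (id : E → E) V (n := V.card - 1) (by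
      have := Finset.card_pos.2 ⟨a, ha⟩
      omega)
    rw [Finset.image_id, ← direction_affineSpan, hdim, AffineSubspace.direction_top, finrank_top,
      hE] at h1
    omega
  exact exists_path_of_card_lt hE hV hdim ha hb (by omega)

end VertexCount

section Polyhedron

variable {E : Type*} [AddCommGroup E] [Module ℝ E] {ι : Type*}

/-- The solution set of a system of linear inequalities. -/
def polyhedron (a : ι → Module.Dual ℝ E) (b : ι → ℝ) : Set E := {x | ∀ i, a i x ≤ b i}

variable {a : ι → Module.Dual ℝ E} {b : ι → ℝ}

theorem convex_polyhedron : Convex ℝ (polyhedron a b) := by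
  have : polyhedron a b = ⋂ i, {x | a i x ≤ b i} := by ext; simp [polyhedron]
  rw [this]
  exact convex_iInter fun i => convex_halfSpace_le (a i).isLinear (b i)

/-- A point of a polyhedron at which the tight inequalities have full rank is extreme. -/
theorem mem_extremePoints_polyhedron {x : E} (hx : x ∈ polyhedron a b)
    (h : ∀ d, (∀ i, a i x = b i → a i d = 0) → d = 0) :
    x ∈ Set.extremePoints ℝ (polyhedron a b) := by
  refine ⟨hx, ?_⟩
  rintro y hy z hz ⟨s, t, hs, ht, hst, rfl⟩
  have h1 : t • (y - z) = 0 := h _ fun i hi => by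
    have h2 := hy i
    have h3 := hz i
    simp only [map_add, map_smul, map_sub, smul_eq_mul] at hi ⊢
    have hb : s * b i + t * b i = b i := by rw [← add_mul, hst, one_mul]
    have h4 : a i y = b i := by
      refine le_antisymm h2 ?_
      have := mul_le_mul_of_nonneg_left h3 ht.le
      have h5 : s * b i ≤ s * a i y := by linarith
      exact le_of_mul_le_mul_left h5 hs
    have h6 : a i z = b i := by
      refine le_antisymm h3 ?_
      have := mul_le_mul_of_nonneg_left h2 hs.le
      have h5 : t * b i ≤ t * a i z := by linarith
      exact le_of_mul_le_mul_left h5 ht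
    rw [h4, h6, sub_self, mul_zero]
  rw [smul_eq_zero, sub_eq_zero] at h1
  rw [← h1.resolve_left ht.ne', ← add_smul, hst, one_smul]

/-- From a point of a polyhedron one can move backwards along every direction that keeps its tight
inequalities valid. -/
theorem exists_sub_smul_mem_polyhedron [Finite ι] {x d : E} (hx : x ∈ polyhedron a b)
    (hd : ∀ i, a i x = b i → 0 ≤ a i d) : ∃ t : ℝ, 0 < t ∧ x - t • d ∈ polyhedron a b := by
  have h1 : ∀ i, ∀ᶠ t : ℝ in nhdsWithin 0 (Set.Ioi 0), a i (x - t • d) ≤ b i := by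
    intro i
    rcases (hx i).lt_or_eq with h | h
    · have hc : Continuous fun t : ℝ => a i (x - t • d) := by
        simp only [map_sub, map_smul, smul_eq_mul]
        fun_prop
      have h0 : (fun t : ℝ => a i (x - t • d)) 0 < b i := by simpa using h
      exact nhdsWithin_le_nhds ((hc.continuousAt.eventually_lt continuousAt_const h0).mono
        fun t ht => ht.le)
    · filter_upwards [self_mem_nhdsWithin] with t ht
      have h2 := mul_nonneg (le_of_lt (Set.mem_Ioi.1 ht)) (hd i h)
      simp only [map_sub, map_smul, smul_eq_mul]
      linarith
  obtain ⟨t, ht, ht0⟩ := ((Filter.eventually_all.2 h1).and self_mem_nhdsWithin).exists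
  exact ⟨t, ht0, ht⟩

theorem mem_openSegment_sub_smul {x y : E} {t : ℝ} (ht : 0 < t) :
    x ∈ openSegment ℝ y (x - t • (y - x)) := by
  have h := mem_openSegment_extension (r := x) (x := y) ht
  rwa [show x + t • (x - y) = x - t • (y - x) by module] at h

theorem finite_extremePoints_polyhedron [Finite ι] :
    (Set.extremePoints ℝ (polyhedron a b)).Finite := by
  refine Set.Finite.of_injOn (f := fun x => {i | a i x = b i}) (t := Set.univ)
    (fun _ _ => Set.mem_univ _) ?_ Set.finite_univ
  intro x hx y hy hxy
  have hxy : ∀ i, a i x = b i → a i y = b i := fun i hi =>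
    (Set.ext_iff.1 hxy i).1 hi
  obtain ⟨t, ht, h⟩ := exists_sub_smul_mem_polyhedron (d := y - x) hx.1 fun i hi => by
    rw [map_sub, hi, hxy i hi, sub_self]
  exact (hx.2 hy.1 h (mem_openSegment_sub_smul ht)).symm

end Polyhedron

section Facets

variable {E : Type*} [NormedAddCommGroup E] [NormedSpace ℝ E] [FiniteDimensional ℝ E]
  {ι : Type*} {a : ι → Module.Dual ℝ E} {b : ι → ℝ}

omit [FiniteDimensional ℝ E] in
theorem exists_finset_convexHull_eq_polyhedron [Finite ι] (hcomp : IsCompact (polyhedron a b)) :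
    ∃ V : Finset E, (V : Set E) = Set.extremePoints ℝ (polyhedron a b) ∧
      convexHull ℝ (V : Set E) = polyhedron a b := by
  have hfin := finite_extremePoints_polyhedron (a := a) (b := b)
  refine ⟨hfin.toFinset, hfin.coe_toFinset, ?_⟩
  rw [hfin.coe_toFinset]
  have := closure_convexHull_extremePoints hcomp convex_polyhedron
  rwa [(hfin.isClosed_convexHull ℝ).closure_eq] at this

omit [FiniteDimensional ℝ E] in
/-- A polyhedron with a strictly interior point is full-dimensional. -/
theorem affineSpan_polyhedron [Finite ι] {x₀ : E} (hx₀ : ∀ i, a i x₀ < b i) :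
    affineSpan ℝ (polyhedron a b) = ⊤ := by
  have hmem : x₀ ∈ polyhedron a b := fun i => (hx₀ i).le
  refine (AffineSubspace.direction_eq_top_iff_of_nonempty
    ((affineSpan_nonempty ℝ).2 ⟨x₀, hmem⟩)).1 (eq_top_iff.2 fun d _ => ?_)
  obtain ⟨t, ht, h⟩ := exists_sub_smul_mem_polyhedron (d := d) hmem
    fun i hi => ((hx₀ i).ne hi).elim
  rw [direction_affineSpan]
  have h1 := vsub_mem_vectorSpan ℝ hmem h
  rw [vsub_eq_sub, sub_sub_cancel] at h1
  simpa [smul_smul, ht.ne'] using Submodule.smul_mem _ t⁻¹ h1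

/-- Every facet is cut out by one of the inequalities. -/
theorem numFacets_polyhedron_le [Fintype ι] (hE : Module.finrank ℝ E = 3)
    (hcomp : IsCompact (polyhedron a b)) (ha : ∀ i, a i ≠ 0) {x₀ : E} (hx₀ : ∀ i, a i x₀ < b i) :
    numFacets (polyhedron a b) ≤ Fintype.card ι := by
  obtain ⟨V, -, hV⟩ := exists_finset_convexHull_eq_polyhedron hcomp
  have hmem : x₀ ∈ polyhedron a b := fun i => (hx₀ i).le
  have hspan := affineSpan_polyhedron hx₀
  have hdim : setDim (polyhedron a b) = 3 := (setDim_eq_three_iff hE ⟨x₀, hmem⟩).2 hspan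
  have hsub : {F | IsFacet (polyhedron a b) F} ⊆
      Set.range fun i => {x ∈ polyhedron a b | a i x = b i} := by
    intro F hF
    obtain ⟨hF, hF2⟩ := (isFacet_iff hdim).1 hF
    have hne : F.Nonempty := by
      rw [Set.nonempty_iff_ne_empty]
      rintro rfl
      rw [vectorSpan_empty, finrank_bot] at hF2
      omega
    rw [← hV] at hF
    obtain ⟨r, hr, hrel⟩ := hF.exists_relative_center hne
    have hrP : r ∈ polyhedron a b := hV ▸ hF.2.subset hr
    obtain ⟨i, hi⟩ : ∃ i, a i r = b i := by
      by_contra! hcon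
      have : F = polyhedron a b := by
        refine Set.Subset.antisymm (hV ▸ hF.2.subset) fun x hx => ?_
        obtain ⟨t, ht, h⟩ := exists_sub_smul_mem_polyhedron (d := x - r) hrP
          fun i hi => (hcon i hi).elim
        rw [hV] at hF
        exact hF.2.left_mem_of_mem_openSegment hx h hr (mem_openSegment_sub_smul ht)
      rw [← direction_affineSpan, this, hspan, AffineSubspace.direction_top, finrank_top, hE] at hF2
      omega
    have hFi : ∀ x ∈ F, a i x = b i := by
      intro x hx
      obtain ⟨t, ht, h⟩ := hrel x (mem_affineSpan ℝ hx)
      have h1 : a i (r + t • (r - x)) ≤ b i := (hV ▸ hF.2.subset h : _ ∈ polyhedron a b) i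
      have h2 : a i x ≤ b i := (hV ▸ hF.2.subset hx : _ ∈ polyhedron a b) i
      simp only [map_add, map_smul, map_sub, smul_eq_mul, hi] at h1
      nlinarith
    refine ⟨i, ?_⟩
    refine Set.Subset.antisymm ?_ fun x hx => ⟨hV ▸ hF.2.subset hx, hFi x hx⟩
    rintro x ⟨hx, hxi⟩
    refine hF.mem_of_mem_affineSpan (hV ▸ hx) ?_
    have hker : Module.finrank ℝ (LinearMap.ker (a i)) = 2 := by
      have h1 := LinearMap.finrank_range_add_finrank_ker (a i)
      have h2 : LinearMap.range (a i) = ⊤ := LinearMap.range_eq_top.2 (LinearMap.surjective (ha i))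
      rw [h2, finrank_top, Module.finrank_self, hE] at h1
      omega
    have heq : vectorSpan ℝ F = LinearMap.ker (a i) :=
      Submodule.eq_of_le_of_finrank_eq (mem_vectorSpan_of_apply_eq hFi) (hF2.trans hker.symm)
    have h1 : x - r ∈ vectorSpan ℝ F := by
      rw [heq, LinearMap.mem_ker, map_sub, hxi, hi, sub_self]
    rw [← direction_affineSpan] at h1
    simpa using AffineSubspace.vadd_mem_of_mem_direction h1 (mem_affineSpan ℝ hr)
  calc numFacets (polyhedron a b) ≤
      (Set.range fun i => {x ∈ polyhedron a b | a i x = b i}).ncard :=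
        Set.ncard_le_ncard hsub (Set.finite_range _)
    _ ≤ Fintype.card ι := by
      rw [← Set.image_univ, ← Nat.card_eq_fintype_card, ← Set.ncard_univ]
      exact Set.ncard_image_le Set.finite_univ

end Facets

section Levels

variable {E : Type*} [AddCommGroup E] [Module ℝ E]

/-- The section of `P` at height `w` is a triangle whose corners are extreme points of `P`. -/
def IsTriangularLevel (P : Set E) (h : Module.Dual ℝ E) (w : ℝ) : Prop :=
  ∃ T : Finset E, T.card = 3 ∧ (∀ v ∈ T, v ∈ Set.extremePoints ℝ P ∧ h v = w) ∧
    {x ∈ P | h x = w} ⊆ convexHull ℝ (T : Set E)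

theorem PolyAdj.le_of_lt {P : Set E} {h : Module.Dual ℝ E} {w : ℝ} (hP : Convex ℝ P)
    (hw : IsTriangularLevel P h w) {x y : E} (hxy : PolyAdj P x y) (hx : h x < w) : h y ≤ w := by
  by_contra! hy
  obtain ⟨T, -, hT, hsub⟩ := hw
  obtain ⟨-, hxP, hyP, hface⟩ := hxy
  have h0 : 0 < h y - h x := by linarith
  set t : ℝ := (w - h x) / (h y - h x) with ht
  have ht0 : 0 < t := div_pos (by linarith) h0
  have ht1 : t < 1 := (div_lt_one h0).2 (by linarith)
  have hp : x + t • (y - x) ∈ segment ℝ x y :=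
    ⟨1 - t, t, by linarith, ht0.le, by ring, by module⟩
  have hpw : h (x + t • (y - x)) = w := by
    simp only [map_add, map_smul, map_sub, smul_eq_mul]
    rw [ht, div_mul_cancel₀ _ h0.ne']
    ring
  have hpT := hsub ⟨hface.subset hp, hpw⟩
  have hTP : convexHull ℝ (T : Set E) ⊆ P := convexHull_min (fun v hv => (hT v hv).1.1) hP
  have hext : IsExtreme ℝ (convexHull ℝ (T : Set E)) (segment ℝ x y ∩ convexHull ℝ (T : Set E)) :=
    ⟨Set.inter_subset_right, fun u hu v hv z hz huv =>
      ⟨hface.left_mem_of_mem_openSegment (hTP hu) (hTP hv) hz.1 huv, hu⟩⟩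
  obtain ⟨v, hvT, hv, -⟩ := convexHull_nonempty_iff.1 ⟨_, hext.subset_convexHull_inter ⟨hp, hpT⟩⟩
  obtain ⟨hvP, hvw⟩ := hT v hvT
  rw [← insert_endpoints_openSegment] at hv
  rcases hv with rfl | rfl | hv
  · exact hx.ne hvw
  · exact hy.ne' hvw
  · exact hx.ne (by rw [hvP.2 hxP.1 hyP.1 hv, hvw])

theorem succ_le_of_level_le {P : Set E} {h : Module.Dual ℝ E} {w : ℕ → ℝ} {m L : ℕ} {f : ℕ → E}
    (hP : Convex ℝ P) (hw : StrictMonoOn w (Set.Iio m))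
    (hlev : ∀ i < m, IsTriangularLevel P h (w i)) (hf : ∀ i < L, PolyAdj P (f i) (f (i + 1)))
    (h0 : h (f 0) < w 0) : ∀ i < m, ∀ t ≤ L, w i ≤ h (f t) → i + 1 ≤ t := by
  intro i
  induction i with
  | zero =>
    intro _ t _ h
    rcases t.eq_zero_or_pos with rfl | ht
    · exact absurd h0 h.not_gt
    · exact ht
  | succ i ih =>
    intro hi t ht h
    have hwi := hw (Set.mem_Iio.2 (by omega)) (Set.mem_Iio.2 hi) i.lt_succ_self
    have h1 := ih (by omega) t ht (hwi.le.trans h)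
    obtain ⟨t, rfl⟩ : ∃ s, t = s + 1 := ⟨t - 1, by omega⟩
    by_contra hcon
    refine (hwi.trans_le h).not_ge ((hf t (by omega)).le_of_lt hP (hlev i (by omega)) ?_)
    by_contra! h2
    have := ih (by omega) t (by omega) h2
    omega

theorem exists_vertex_lt {V : Finset E} (h : Module.Dual ℝ E) {c : ℝ}
    (hx : ∃ x ∈ convexHull ℝ (V : Set E), h x < c) : ∃ v ∈ V, h v < c := by
  obtain ⟨x, hx, hxc⟩ := hx
  by_contra! hcon
  have := apply_le_of_mem_convexHull (A := V) (-h) (c := -c)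
    (fun v hv => neg_le_neg (hcon v hv)) x hx
  exact hxc.not_ge (neg_le_neg_iff.1 this)

end Levels

section Assembly

variable {E : Type*} [NormedAddCommGroup E] [NormedSpace ℝ E] [FiniteDimensional ℝ E]
  {ι : Type*} [Fintype ι] {a : ι → Module.Dual ℝ E} {b : ι → ℝ}

/-- A polyhedron with sufficiently many triangular levels has exactly the prescribed number of
facets, and its graph has large diameter. -/
theorem exists_of_triangularLevels (hE : Module.finrank ℝ E = 3)
    (hcomp : IsCompact (polyhedron a b)) (ha : ∀ i, a i ≠ 0) {x₀ : E} (hx₀ : ∀ i, a i x₀ < b i)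
    {n m d : ℕ} (hcard : Fintype.card ι = n) (hm : 1 ≤ m) (hn : 2 * n ≤ 2 * m + d + 6)
    (h : Module.Dual ℝ E) (w : ℕ → ℝ) (hw : StrictMonoOn w (Set.Iio m))
    (hlev : ∀ i < m, IsTriangularLevel (polyhedron a b) h (w i)) (hlow : h x₀ < w 0)
    (htop : d = m ∨ d = m + 1 ∧ ∃ x ∈ polyhedron a b, w (m - 1) < h x) :
    ∃ S : Finset E, S.Nonempty ∧ setDim (convexHull ℝ (S : Set E)) = 3 ∧
      numFacets (convexHull ℝ (S : Set E)) = n ∧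
      ∃ u ∈ Set.extremePoints ℝ (convexHull ℝ (S : Set E)),
        ∃ v ∈ Set.extremePoints ℝ (convexHull ℝ (S : Set E)),
          ∀ L : ℕ, HasPathOfLength (convexHull ℝ (S : Set E)) u v L → d ≤ L := by
  classical
  obtain ⟨V, hVext, hVP⟩ := exists_finset_convexHull_eq_polyhedron hcomp
  have hmem : x₀ ∈ polyhedron a b := fun i => (hx₀ i).le
  have hspan := affineSpan_polyhedron hx₀
  have hdim : setDim (polyhedron a b) = 3 := (setDim_eq_three_iff hE ⟨x₀, hmem⟩).2 hspan
  have hfac := numFacets_polyhedron_le hE hcomp ha hx₀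
  have hconv : Convex ℝ (polyhedron a b) := convex_polyhedron
  rw [← hVP] at hVext hspan hdim hfac hconv htop hmem hlev
  rw [affineSpan_convexHull] at hspan
  have hV : ∀ v, v ∈ V ↔ v ∈ Set.extremePoints ℝ (convexHull ℝ (V : Set E)) := fun v => by
    rw [← hVext, Finset.mem_coe]
  have hcount := card_add_four_le hE (fun v hv => (hV v).1 hv) hspan
  obtain ⟨u, huV, hu⟩ := exists_vertex_lt h ⟨x₀, hmem, hlow⟩
  choose! T hT3 hT hTsub using hlev
  have hle : ∀ i < m, w 0 ≤ w i ∧ w i ≤ w (m - 1) := fun i hi =>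
    ⟨hw.monotoneOn (Set.mem_Iio.2 hm) (Set.mem_Iio.2 hi) i.zero_le,
      hw.monotoneOn (Set.mem_Iio.2 hi) (Set.mem_Iio.2 (by omega)) (by omega)⟩
  have hUcard : ((Finset.range m).biUnion T).card = 3 * m := by
    rw [Finset.card_biUnion, Finset.sum_congr rfl fun i hi => hT3 i (Finset.mem_range.1 hi)]
    · simp [mul_comm]
    · intro i hi j hj hij
      rw [Function.onFun, Finset.disjoint_left]
      intro v hvi hvj
      have hi := Finset.mem_range.1 hi
      have hj := Finset.mem_range.1 hj
      exact hij (hw.injOn hi hj (((hT i hi v hvi).2.symm.trans (hT j hj v hvj).2)))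
  have hU : ∀ v ∈ (Finset.range m).biUnion T, v ∈ V ∧ w 0 ≤ h v ∧ h v ≤ w (m - 1) := by
    intro v hv
    obtain ⟨i, hi, hvi⟩ := Finset.mem_biUnion.1 hv
    have hi := Finset.mem_range.1 hi
    obtain ⟨h1, h2⟩ := hT i hi v hvi
    rw [hV, h2]
    exact ⟨h1, hle i hi⟩
  have huU : u ∉ (Finset.range m).biUnion T := fun h' => hu.not_ge (hU u h').2.1
  have hlev' : ∀ i < m, IsTriangularLevel (convexHull ℝ (V : Set E)) h (w i) := fun i hi =>
    ⟨T i, hT3 i hi, hT i hi, hTsub i hi⟩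
  have main : ∃ v ∈ V, 3 * m + 1 + (d - m) ≤ V.card ∧
      ∀ L : ℕ, HasPathOfLength (convexHull ℝ (V : Set E)) u v L → d ≤ L := by
    rcases htop with rfl | ⟨rfl, htop⟩
    · obtain ⟨v, hv⟩ := Finset.card_pos.1 (by rw [hT3 (d - 1) (by omega)]; omega)
      have hv' := hT (d - 1) (by omega) v hv
      refine ⟨v, (hV v).2 hv'.1, ?_, ?_⟩
      · rw [Nat.sub_self, add_zero, ← hUcard, ← Finset.card_insert_of_notMem huU]
        exact Finset.card_le_card (Finset.insert_subset huV fun v hv => (hU v hv).1)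
      · rintro L ⟨f, rfl, rfl, hf⟩
        have := succ_le_of_level_le hconv hw hlev' hf hu (d - 1) (by omega) L le_rfl hv'.2.ge
        omega
    · obtain ⟨v, hv, hvw⟩ : ∃ v ∈ V, w (m - 1) < h v := by
        obtain ⟨x, hx, hxw⟩ := htop
        obtain ⟨v, hv, h'⟩ := exists_vertex_lt (-h) (c := -w (m - 1)) ⟨x, hx, neg_lt_neg hxw⟩
        exact ⟨v, hv, neg_lt_neg_iff.1 h'⟩
      have hvU : v ∉ insert u ((Finset.range m).biUnion T) := by
        rw [Finset.mem_insert, not_or]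
        refine ⟨?_, fun h' => hvw.not_ge (hU v h').2.2⟩
        rintro rfl
        exact (hu.trans_le (hle (m - 1) (by omega)).1).not_gt hvw
      refine ⟨v, hv, ?_, ?_⟩
      · have h1 := Finset.card_le_card (s := insert v (insert u ((Finset.range m).biUnion T)))
          (t := V) (Finset.insert_subset hv (Finset.insert_subset huV fun v hv => (hU v hv).1))
        rw [Finset.card_insert_of_notMem hvU, Finset.card_insert_of_notMem huU, hUcard] at h1
        omega
      · rintro L ⟨f, rfl, rfl, hf⟩
        have key := succ_le_of_level_le hconv hw hlev' hf hu (m - 1) (by omega)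
        have h1 := key L le_rfl hvw.le
        obtain ⟨L, rfl⟩ : ∃ s, L = s + 1 := ⟨L - 1, by omega⟩
        by_contra hcon
        refine hvw.not_ge ((hf L L.lt_succ_self).le_of_lt hconv (hlev' (m - 1) (by omega)) ?_)
        by_contra! h2
        have := key L L.le_succ h2
        omega
  obtain ⟨v, hvV, hVcard, hL⟩ := main
  refine ⟨V, ⟨u, huV⟩, hdim, ?_, u, (hV u).1 huV, v, (hV v).1 hvV, hL⟩
  rcases htop with rfl | ⟨rfl, -⟩ <;> omega

end Assembly

section Tower

/-- Three linear forms with sum zero on the horizontal plane. -/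
def triForm : Fin 3 → Module.Dual ℝ (Fin 3 → ℝ) :=
  let x : Module.Dual ℝ (Fin 3 → ℝ) := LinearMap.proj 0
  let y : Module.Dual ℝ (Fin 3 → ℝ) := LinearMap.proj 1
  ![x, y, -x - y]

/-- The vertical coordinate. -/
def height : Module.Dual ℝ (Fin 3 → ℝ) := LinearMap.proj 2

@[simp] theorem height_apply (x : Fin 3 → ℝ) : height x = x 2 := rfl
@[simp] theorem triForm_zero (x : Fin 3 → ℝ) : triForm 0 x = x 0 := rfl
@[simp] theorem triForm_one (x : Fin 3 → ℝ) : triForm 1 x = x 1 := rfl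
@[simp] theorem triForm_two (x : Fin 3 → ℝ) : triForm 2 x = -x 0 - x 1 := rfl

/-- The corners of the triangle `s * triForm m x ≤ A` at height `w`. -/
def corner (s A w : ℝ) (m : Fin 3) : Fin 3 → ℝ :=
  ![if m = 0 then -(2 * A) * s else A * s, if m = 1 then -(2 * A) * s else A * s, w]

@[simp] theorem corner_height (s A w : ℝ) (m : Fin 3) : corner s A w m 2 = w := rfl

theorem triForm_corner (s A w : ℝ) (m l : Fin 3) :
    triForm l (corner s A w m) = if l = m then -(2 * A) * s else A * s := by
  fin_cases m <;> fin_cases l <;> simp [corner] <;> ring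

theorem corner_injective {s A w : ℝ} (hs : s * s = 1) (hA : 0 < A) :
    Function.Injective (corner s A w) := by
  intro m l h
  by_contra hne
  have h1 := congrArg (fun x => triForm m x * s) h
  simp only [triForm_corner, if_true, if_neg hne, mul_assoc, hs] at h1
  linarith

theorem isTriangularLevel_of_corner {P : Set (Fin 3 → ℝ)} {s A w : ℝ} (hs : s * s = 1)
    (hA : 0 < A) (hext : ∀ m, corner s A w m ∈ Set.extremePoints ℝ P)
    (hsub : ∀ x ∈ P, x 2 = w → ∀ m, s * triForm m x ≤ A) : IsTriangularLevel P height w := by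
  classical
  refine ⟨Finset.univ.image (corner s A w), ?_, ?_, ?_⟩
  · rw [Finset.card_image_of_injective _ (corner_injective hs hA)]
    simp
  · intro v hv
    obtain ⟨m, -, rfl⟩ := Finset.mem_image.1 hv
    exact ⟨hext m, by simp⟩
  · rintro x ⟨hx, hxw⟩
    have h0 := hsub x hx hxw
    have h1 := (convex_convexHull ℝ (Set.range (corner s A w))).sum_mem (t := Finset.univ)
      (w := fun m => (A - s * triForm m x) / (3 * A)) (z := corner s A w)
      (fun m _ => div_nonneg (by linarith [h0 m]) (by linarith))
      (by simp only [Fin.sum_univ_three, triForm_zero, triForm_one, triForm_two]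
          field_simp
          ring)
      (fun m _ => subset_convexHull ℝ _ ⟨m, rfl⟩)
    have h2 : x = ∑ m, ((A - s * triForm m x) / (3 * A)) • corner s A w m := by
      have h3 : s ^ 2 = 1 := by rw [sq, hs]
      rw [Fin.sum_univ_three]
      ext l
      fin_cases l
      · simp [corner]
        field_simp
        linear_combination (-(3 * x 0)) * h3
      · simp [corner]
        field_simp
        linear_combination (-(3 * x 1)) * h3
      · simp only [height_apply] at hxw
        simp [corner, hxw]
        field_simp
        ring
    rw [Finset.coe_image, Finset.coe_univ, Set.image_univ, h2]
    exact h1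

/-- The linear part of the inequality `(-1) ^ j * triForm m x ≤ 4 ^ j + x 2 / 4 ^ j`. -/
def towerForm (j : ℕ) (m : Fin 3) : Module.Dual ℝ (Fin 3 → ℝ) :=
  (-1 : ℝ) ^ j • triForm m - ((4 : ℝ) ^ j)⁻¹ • height

theorem towerForm_apply (j : ℕ) (m : Fin 3) (x : Fin 3 → ℝ) :
    towerForm j m x = (-1 : ℝ) ^ j * triForm m x - ((4 : ℝ) ^ j)⁻¹ * x 2 := rfl

theorem towerForm_ne_zero (j : ℕ) (m : Fin 3) : towerForm j m ≠ 0 := by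
  intro h
  have h1 := congrArg (fun f => f ![0, 0, 1]) h
  have h2 : triForm m ![0, 0, 1] = 0 := by fin_cases m <;> simp
  simp [towerForm_apply, h2] at h1

variable {κ : Type*}

/-- The inequalities of the tower with `K + 1` layers, together with additional ones. -/
def towerForms (K : ℕ) (c : κ → Module.Dual ℝ (Fin 3 → ℝ)) :
    (Fin (K + 1) × Fin 3) ⊕ κ → Module.Dual ℝ (Fin 3 → ℝ) :=
  Sum.elim (fun q => towerForm q.1 q.2) c

def towerBounds (K : ℕ) (e : κ → ℝ) : (Fin (K + 1) × Fin 3) ⊕ κ → ℝ :=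
  Sum.elim (fun q => 4 ^ (q.1 : ℕ)) e

def tower (K : ℕ) (c : κ → Module.Dual ℝ (Fin 3 → ℝ)) (e : κ → ℝ) : Set (Fin 3 → ℝ) :=
  polyhedron (towerForms K c) (towerBounds K e)

variable {K : ℕ} {c : κ → Module.Dual ℝ (Fin 3 → ℝ)} {e : κ → ℝ}

theorem mem_tower {x : Fin 3 → ℝ} : x ∈ tower K c e ↔
    (∀ j ≤ K, ∀ m, (-1 : ℝ) ^ j * triForm m x ≤ 4 ^ j + x 2 / 4 ^ j) ∧ ∀ i, c i x ≤ e i := by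
  constructor
  · intro h
    refine ⟨fun j hj m => ?_, fun i => h (.inr i)⟩
    have := h (.inl (⟨j, by omega⟩, m))
    simp only [towerForms, towerBounds, Sum.elim_inl, towerForm_apply] at this
    rw [div_eq_inv_mul]
    linarith
  · rintro ⟨h1, h2⟩ (⟨⟨j, hj⟩, m⟩ | i)
    · have := h1 j (by omega) m
      rw [div_eq_inv_mul] at this
      simp only [towerForms, towerBounds, Sum.elim_inl, towerForm_apply]
      linarith
    · exact h2 i

theorem mem_extremePoints_tower {x : Fin 3 → ℝ} (hx : x ∈ tower K c e)
    (h : ∀ d : Fin 3 → ℝ,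
      (∀ j ≤ K, ∀ m, (-1 : ℝ) ^ j * triForm m x = 4 ^ j + x 2 / 4 ^ j →
        (-1 : ℝ) ^ j * triForm m d = d 2 / 4 ^ j) →
      (∀ i, c i x = e i → c i d = 0) → d = 0) : x ∈ Set.extremePoints ℝ (tower K c e) := by
  refine mem_extremePoints_polyhedron hx fun d hd => h d (fun j hj m hjm => ?_) fun i => hd (.inr i)
  have := hd (.inl (⟨j, by omega⟩, m))
  simp only [towerForms, towerBounds, Sum.elim_inl, towerForm_apply] at this
  rw [div_eq_inv_mul] at hjm ⊢
  have := this (by linarith)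
  linarith

theorem neg_one_pow_mul_self (j : ℕ) : (-1 : ℝ) ^ j * (-1 : ℝ) ^ j = 1 := by
  rw [← mul_pow]; norm_num

theorem eq_zero_of_triForm {d : Fin 3 → ℝ} {m : Fin 3} (h : ∀ l ≠ m, triForm l d = 0)
    (h2 : d 2 = 0) : d = 0 := by
  have : d 0 = 0 ∧ d 1 = 0 := by
    fin_cases m
    · have h1 := h 1 (by decide)
      have h2 := h 2 (by decide)
      simp only [triForm_one, triForm_two] at h1 h2
      exact ⟨by linarith, h1⟩
    · have h1 := h 0 (by decide)
      have h2 := h 2 (by decide)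
      simp only [triForm_zero, triForm_two] at h1 h2
      exact ⟨h1, by linarith⟩
    · exact ⟨h 0 (by decide), h 1 (by decide)⟩
  ext l
  fin_cases l
  · exact this.1
  · exact this.2
  · exact h2

theorem triForm_corner_bounds {s A w t : ℝ} (hs : s * s = 1) (ht : t = s ∨ t = -s) (hA : 0 < A)
    (m l : Fin 3) : t * triForm l (corner s A w m) ≤ 2 * A := by
  rw [triForm_corner]
  rcases ht with rfl | rfl <;> split_ifs <;> nlinarith

theorem neg_one_pow_eq_or_neg (i j : ℕ) : (-1 : ℝ) ^ i = (-1) ^ j ∨ (-1 : ℝ) ^ i = -(-1) ^ j := by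
  rcases neg_one_pow_eq_or ℝ i with h | h <;> rcases neg_one_pow_eq_or ℝ j with h' | h' <;>
    simp [h, h']

theorem corner_mem_tower {j : ℕ} {w A : ℝ} (hA : 0 < A) (hjA : A = 4 ^ j + w / 4 ^ j)
    (hother : ∀ i ≤ K, i ≠ j → 2 * A ≤ 4 ^ i + w / 4 ^ i) (m : Fin 3)
    (hcap : ∀ i, c i (corner ((-1) ^ j) A w m) ≤ e i) :
    corner ((-1) ^ j) A w m ∈ tower K c e := by
  refine mem_tower.2 ⟨fun i hi l => ?_, hcap⟩
  rw [corner_height]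
  by_cases hij : i = j
  · subst hij
    rw [triForm_corner, ← hjA]
    split_ifs
    · nlinarith [neg_one_pow_mul_self i]
    · nlinarith [neg_one_pow_mul_self i]
  · exact (triForm_corner_bounds (neg_one_pow_mul_self j) (neg_one_pow_eq_or_neg i j) hA m l).trans
      (hother i hi hij)

/-- A level at which one layer is active and all the others are at least twice as wide. -/
theorem isTriangularLevel_tower {j : ℕ} (hj : j ≤ K) {w A : ℝ} (hA : 0 < A)
    (hjA : A = 4 ^ j + w / 4 ^ j) (hother : ∀ i ≤ K, i ≠ j → 2 * A ≤ 4 ^ i + w / 4 ^ i)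
    (hcap : ∀ m, ∀ i, c i (corner ((-1) ^ j) A w m) ≤ e i)
    (hindep : ∀ m, ∀ d : Fin 3 → ℝ, (∀ l ≠ m, (-1 : ℝ) ^ j * triForm l d = d 2 / 4 ^ j) →
      (∀ i ≤ K, ∀ l, (-1 : ℝ) ^ i * triForm l (corner ((-1) ^ j) A w m) = 4 ^ i + w / 4 ^ i →
        (-1 : ℝ) ^ i * triForm l d = d 2 / 4 ^ i) →
      (∀ i, c i (corner ((-1) ^ j) A w m) = e i → c i d = 0) → d 2 = 0) :
    IsTriangularLevel (tower K c e) height w := by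
  refine isTriangularLevel_of_corner (neg_one_pow_mul_self j) hA (fun m => ?_) ?_
  · refine mem_extremePoints_tower (corner_mem_tower hA hjA hother m (hcap m)) ?_
    intro d h1 h2
    have h3 : ∀ l ≠ m, (-1 : ℝ) ^ j * triForm l d = d 2 / 4 ^ j := fun l hl =>
      h1 j hj l (by
        rw [triForm_corner, if_neg hl, corner_height, ← hjA, mul_comm A, ← mul_assoc,
          neg_one_pow_mul_self, one_mul])
    have hd := hindep m d h3 (fun i hi l => h1 i hi l) h2
    refine eq_zero_of_triForm (m := m) (fun l hl => ?_) hd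
    have := h3 l hl
    rw [hd, zero_div] at this
    exact (mul_eq_zero.1 this).resolve_left (pow_ne_zero _ (by norm_num))
  · rintro x hx rfl m
    rw [hjA]
    exact (mem_tower.1 hx).1 j hj m

theorem sum_triForm (m : Fin 3) (d : Fin 3 → ℝ) :
    ∃ k l, k ≠ m ∧ l ≠ m ∧ triForm m d = -(triForm k d + triForm l d) := by
  fin_cases m
  · exact ⟨1, 2, by decide, by decide, by simp⟩
  · exact ⟨0, 2, by decide, by decide, by simp⟩
  · exact ⟨0, 1, by decide, by decide, by simp; ring⟩

/-- Independence is provided by a layer of opposite sign which is exactly twice as wide. -/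
theorem isTriangularLevel_tower_of_neighbour {j i : ℕ} (hj : j ≤ K) (hi : i ≤ K)
    (hij : (-1 : ℝ) ^ i = -(-1) ^ j) (hne : (4 : ℝ) ^ j ≠ 2 * 4 ^ i) {w A : ℝ} (hA : 0 < A)
    (hjA : A = 4 ^ j + w / 4 ^ j) (hiA : 2 * A = 4 ^ i + w / 4 ^ i)
    (hother : ∀ i ≤ K, i ≠ j → 2 * A ≤ 4 ^ i + w / 4 ^ i)
    (hcap : ∀ m, ∀ i, c i (corner ((-1) ^ j) A w m) ≤ e i) :
    IsTriangularLevel (tower K c e) height w := by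
  refine isTriangularLevel_tower hj hA hjA hother hcap fun m d h1 h2 _ => ?_
  have h3 := h2 i hi m (by
    rw [triForm_corner, if_pos rfl, ← hiA, hij]
    linear_combination 2 * A * neg_one_pow_mul_self j)
  obtain ⟨k, l, hk, hl, hsum⟩ := sum_triForm m d
  have hk := h1 k hk
  have hl := h1 l hl
  rw [hsum, hij, neg_mul_neg, mul_add, hk, hl] at h3
  field_simp at h3
  by_contra hd
  refine hne ?_
  have : d 2 * (2 * 4 ^ i - 4 ^ j) = 0 := by linear_combination h3
  linarith [(mul_eq_zero.1 this).resolve_left hd]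

end Tower

section TowerLevels

/-- The heights at which two neighbouring layers of the tower differ by a factor of two. -/
def lev (i : ℕ) : ℝ := if Even i then 8 / 7 * (4 ^ (i / 2)) ^ 2 else 14 * (4 ^ (i / 2)) ^ 2

theorem lev_two_mul (j : ℕ) : lev (2 * j) = 8 / 7 * (4 ^ j) ^ 2 := by
  rw [lev, if_pos (even_two_mul j), Nat.mul_div_cancel_left j two_pos]

theorem lev_two_mul_add_one (j : ℕ) : lev (2 * j + 1) = 14 * (4 ^ j) ^ 2 := by
  rw [lev, if_neg (by simp), show (2 * j + 1) / 2 = j by omega]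

theorem strictMono_lev : StrictMono lev := by
  refine strictMono_nat_of_lt_succ fun i => ?_
  have h4 : ∀ j : ℕ, (0 : ℝ) < (4 ^ j) ^ 2 := fun j => by positivity
  obtain ⟨j, rfl | rfl⟩ := i.even_or_odd'
  · rw [lev_two_mul, lev_two_mul_add_one]
    linarith [h4 j]
  · rw [show 2 * j + 1 + 1 = 2 * (j + 1) by ring, lev_two_mul, lev_two_mul_add_one, pow_succ (4 : ℝ)]
    linarith [h4 j, mul_pow ((4 : ℝ) ^ j) 4 2]

theorem pow_four_le_or (i j : ℕ) (hij : i ≠ j) : (4 : ℝ) ^ i ≤ 4 ^ j / 4 ∨ 4 * (4 : ℝ) ^ j ≤ 4 ^ i := by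
  rcases hij.lt_or_gt with h | h
  · left
    rw [le_div_iff₀ (by norm_num), ← pow_succ]
    exact pow_le_pow_right₀ (by norm_num) h
  · right
    rw [mul_comm, ← pow_succ]
    exact pow_le_pow_right₀ (by norm_num) h

theorem add_le_add_mul_div {p q v : ℝ} (hv : 0 < v) (h : v ≤ p ∧ v ≤ q ∨ p ≤ v ∧ q ≤ v) :
    p + q ≤ v + p * q / v := by
  have h1 : v + p * q / v - (p + q) = (v - p) * (v - q) / v := by
    field_simp
    ring
  have h2 : 0 ≤ (v - p) * (v - q) := by
    rcases h with h | h
    · exact mul_nonneg_of_nonpos_of_nonpos (by linarith) (by linarith)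
    · exact mul_nonneg (by linarith) (by linarith)
  linarith [div_nonneg h2 hv.le]

variable {κ : Type*} {K : ℕ} {c : κ → Module.Dual ℝ (Fin 3 → ℝ)} {e : κ → ℝ}

theorem isTriangularLevel_lev
    (hcap : ∀ x : Fin 3 → ℝ, x 2 ≤ 8 / 7 * (4 ^ K) ^ 2 →
      (∀ m, (-1 : ℝ) ^ K * triForm m x ≤ 15 / 7 * 4 ^ K) → ∀ i, c i x ≤ e i)
    (hindep : ∀ m, ∀ d : Fin 3 → ℝ, (∀ l ≠ m, (-1 : ℝ) ^ K * triForm l d = d 2 / 4 ^ K) →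
      (∀ i, c i (corner ((-1) ^ K) (15 / 7 * 4 ^ K) (8 / 7 * (4 ^ K) ^ 2) m) = e i → c i d = 0) →
      d 2 = 0) :
    ∀ i < 2 * K + 1, IsTriangularLevel (tower K c e) height (lev i) := by
  have hcap' : ∀ {j : ℕ} {w A : ℝ}, 0 < A → A = 4 ^ j + w / 4 ^ j →
      (∀ i ≤ K, i ≠ j → 2 * A ≤ 4 ^ i + w / 4 ^ i) → w ≤ 8 / 7 * (4 ^ K) ^ 2 →
      ∀ m, ∀ i, c i (corner ((-1) ^ j) A w m) ≤ e i := by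
    intro j w A hA hjA hother hw m
    refine hcap _ hw fun l => ?_
    have h1 := (mem_tower.1 (corner_mem_tower (c := fun i : Empty => i.elim)
      (e := fun i : Empty => i.elim) hA hjA hother m fun i => i.elim)).1 K le_rfl l
    rw [corner_height] at h1
    have hK : (0 : ℝ) < 4 ^ K := by positivity
    have h2 : w / 4 ^ K ≤ 8 / 7 * 4 ^ K := by
      rw [div_le_iff₀ hK]
      linarith [sq ((4 : ℝ) ^ K)]
    linarith
  intro i hi
  have hlev : lev i ≤ 8 / 7 * (4 ^ K) ^ 2 := by
    rw [← lev_two_mul]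
    exact strictMono_lev.monotone (by omega)
  obtain ⟨j, rfl | rfl⟩ := i.even_or_odd'
  · have hu : (0 : ℝ) < 4 ^ j := by positivity
    have hA : (0 : ℝ) < 15 / 7 * 4 ^ j := by positivity
    have hjA : (15 / 7 * 4 ^ j : ℝ) = 4 ^ j + lev (2 * j) / 4 ^ j := by
      rw [lev_two_mul]
      field_simp
      ring
    have hother : ∀ i ≤ K, i ≠ j → 2 * (15 / 7 * 4 ^ j : ℝ) ≤ 4 ^ i + lev (2 * j) / 4 ^ i := by
      intro i _ hij
      have := add_le_add_mul_div (p := 4 * 4 ^ j) (q := 2 / 7 * 4 ^ j) (v := 4 ^ i) (by positivity)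
        (by rcases pow_four_le_or i j hij with h | h
            · exact .inl ⟨by linarith, by linarith⟩
            · exact .inr ⟨by linarith, by linarith⟩)
      rw [lev_two_mul]
      rw [show (8 / 7 * (4 ^ j) ^ 2 : ℝ) = 4 * 4 ^ j * (2 / 7 * 4 ^ j) by ring]
      linarith
    rcases (show j ≤ K by omega).lt_or_eq with hj | rfl
    · refine isTriangularLevel_tower_of_neighbour hj.le (i := j + 1) hj (by ring) ?_ hA hjA ?_
        hother (hcap' hA hjA hother hlev)
      · rw [pow_succ]
        linarith
      · rw [lev_two_mul, pow_succ]
        field_simp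
        ring
    · refine isTriangularLevel_tower le_rfl hA hjA hother (hcap' hA hjA hother hlev) ?_
      intro m d h1 _ h2
      rw [lev_two_mul] at h2
      exact hindep m d h1 h2
  · have hu : (0 : ℝ) < 4 ^ j := by positivity
    have hA : (0 : ℝ) < 15 / 2 * 4 ^ j := by positivity
    have hjA : (15 / 2 * 4 ^ j : ℝ) = 4 ^ (j + 1) + lev (2 * j + 1) / 4 ^ (j + 1) := by
      rw [lev_two_mul_add_one, pow_succ]
      field_simp
      ring
    have hother : ∀ i ≤ K, i ≠ j + 1 →
        2 * (15 / 2 * 4 ^ j : ℝ) ≤ 4 ^ i + lev (2 * j + 1) / 4 ^ i := by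
      intro i _ hij
      have := add_le_add_mul_div (p := 4 ^ j) (q := 14 * 4 ^ j) (v := 4 ^ i) (by positivity)
        (by rcases pow_four_le_or i (j + 1) hij with h | h <;> rw [pow_succ] at h
            · exact .inl ⟨by linarith, by linarith⟩
            · exact .inr ⟨by linarith, by linarith⟩)
      rw [lev_two_mul_add_one]
      rw [show (14 * (4 ^ j) ^ 2 : ℝ) = 4 ^ j * (14 * 4 ^ j) by ring]
      linarith
    refine isTriangularLevel_tower_of_neighbour (j := j + 1) (by omega) (i := j) (by omega)
      (by ring) ?_ hA hjA ?_ hother (hcap' hA hjA hother hlev)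
    · rw [pow_succ]
      linarith
    · rw [lev_two_mul_add_one]
      field_simp
      ring

theorem isCompact_tower {M : ℝ} (hM : ∀ x ∈ tower K c e, x 2 ≤ M) : IsCompact (tower K c e) := by
  have hclosed : IsClosed (tower K c e) := by
    have : tower K c e = ⋂ i, {x | towerForms K c i x ≤ towerBounds K e i} := by
      ext; simp [tower, polyhedron]
    rw [this]
    exact isClosed_iInter fun i => isClosed_le
      (towerForms K c i).continuous_of_finiteDimensional continuous_const
  refine (isCompact_Icc (a := ![-(2 * (1 + M)), -(2 * (1 + M)), -1])
    (b := ![1 + M, 1 + M, M])).of_isClosed_subset hclosed fun x hx => ?_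
  have h := (mem_tower.1 hx).1 0 (Nat.zero_le K)
  have h0 := h 0
  have h1 := h 1
  have h2 := h 2
  simp only [pow_zero, one_mul, div_one, triForm_zero, triForm_one, triForm_two] at h0 h1 h2
  have h3 := hM x hx
  refine ⟨fun l => ?_, fun l => ?_⟩
  · fin_cases l <;> simp <;> linarith
  · fin_cases l <;> simp <;> linarith

theorem exists_of_tower [Fintype κ] {n m d : ℕ} (hn : 3 * (K + 1) + Fintype.card κ = n) {M : ℝ}
    (hM : ∀ x ∈ tower K c e, x 2 ≤ M) (hc : ∀ i, c i ≠ 0) (he : ∀ i, 0 < e i)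
    (hm : 1 ≤ m) (hnm : 2 * n ≤ 2 * m + d + 6) (w : ℕ → ℝ) (hw : StrictMonoOn w (Set.Iio m))
    (hlev : ∀ i < m, IsTriangularLevel (tower K c e) height (w i)) (hw0 : 0 < w 0)
    (htop : d = m ∨ d = m + 1 ∧ ∃ x ∈ tower K c e, w (m - 1) < x 2) :
    ∃ S : Finset (Fin 3 → ℝ), S.Nonempty ∧ setDim (convexHull ℝ (S : Set (Fin 3 → ℝ))) = 3 ∧
      numFacets (convexHull ℝ (S : Set (Fin 3 → ℝ))) = n ∧
      ∃ u ∈ Set.extremePoints ℝ (convexHull ℝ (S : Set (Fin 3 → ℝ))),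
        ∃ v ∈ Set.extremePoints ℝ (convexHull ℝ (S : Set (Fin 3 → ℝ))),
          ∀ L : ℕ, HasPathOfLength (convexHull ℝ (S : Set (Fin 3 → ℝ))) u v L → d ≤ L := by
  refine exists_of_triangularLevels (by simp) (isCompact_tower hM) ?_ (x₀ := 0) ?_
    (by simp [mul_comm, hn.symm]) hm hnm height w hw hlev (by simpa using hw0) htop
  · rintro (q | i)
    · exact towerForm_ne_zero _ _
    · exact hc i
  · rintro (q | i)
    · rw [map_zero]
      exact pow_pos (by norm_num) _
    · rw [map_zero]
      exact he i

end TowerLevels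

section Caps

/-- An inclined linear form. -/
def capForm (s b : ℝ) (m : Fin 3) : Module.Dual ℝ (Fin 3 → ℝ) :=
  s • triForm m + b • height

theorem capForm_apply (s b : ℝ) (m : Fin 3) (x : Fin 3 → ℝ) :
    capForm s b m x = s * triForm m x + b * x 2 := rfl

theorem triForm_vertical (m : Fin 3) (z : ℝ) : triForm m ![0, 0, z] = 0 := by
  fin_cases m <;> simp

theorem capForm_ne_zero (s : ℝ) {b : ℝ} (hb : b ≠ 0) (m : Fin 3) : capForm s b m ≠ 0 := by
  intro h
  have h1 := congrArg (fun f => f ![0, 0, 1]) h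
  simp [capForm_apply, triForm_vertical] at h1
  exact hb h1

theorem vertical_mem_tower {κ : Type*} {K : ℕ} {c : κ → Module.Dual ℝ (Fin 3 → ℝ)} {e : κ → ℝ}
    {z : ℝ} (hz : 0 ≤ z) (h : ∀ i, c i ![0, 0, z] ≤ e i) : ![0, 0, z] ∈ tower K c e := by
  refine mem_tower.2 ⟨fun j _ m => ?_, h⟩
  rw [triForm_vertical, mul_zero]
  exact add_nonneg (by positivity) (div_nonneg hz (by positivity))

theorem mul_triForm_corner {s A w : ℝ} (hs : s * s = 1) (m l : Fin 3) :
    s * triForm l (corner s A w m) = if l = m then -(2 * A) else A := by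
  rw [triForm_corner]
  split_ifs
  · linear_combination -(2 * A) * hs
  · linear_combination A * hs

/-- The bound `H(n, 3) ≥ d`. -/
def HasDiameterAtLeast (n d : ℕ) : Prop :=
  ∃ S : Finset (Fin 3 → ℝ), S.Nonempty ∧ setDim (convexHull ℝ (S : Set (Fin 3 → ℝ))) = 3 ∧
    numFacets (convexHull ℝ (S : Set (Fin 3 → ℝ))) = n ∧
    ∃ a ∈ Set.extremePoints ℝ (convexHull ℝ (S : Set (Fin 3 → ℝ))),
      ∃ b ∈ Set.extremePoints ℝ (convexHull ℝ (S : Set (Fin 3 → ℝ))),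
        ∀ L : ℕ, HasPathOfLength (convexHull ℝ (S : Set (Fin 3 → ℝ))) a b L → d ≤ L

theorem lev_zero_pos : 0 < lev 0 := by
  rw [show 0 = 2 * 0 from rfl, lev_two_mul]
  norm_num

theorem hasDiameterAtLeast_flat_cap (K : ℕ) : HasDiameterAtLeast (3 * K + 4) (2 * K + 1) := by
  refine exists_of_tower (κ := Unit) (K := K) (c := fun _ => height)
    (e := fun _ => 8 / 7 * (4 ^ K) ^ 2) (m := 2 * K + 1) (by simp; ring)
    (M := 8 / 7 * (4 ^ K) ^ 2) (fun x hx => (mem_tower.1 hx).2 ()) (fun _ h => ?_)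
    (fun _ => by positivity) (by omega) (by omega) lev (strictMono_lev.strictMonoOn _)
    (isTriangularLevel_lev (fun x hx _ _ => hx) fun m d _ h => h () rfl) lev_zero_pos (.inl rfl)
  have := congrArg (fun f => f ![0, 0, 1]) h
  simp at this

theorem hasDiameterAtLeast_roof_cap (K : ℕ) : HasDiameterAtLeast (3 * K + 5) (2 * K + 2) := by
  have hu : (0 : ℝ) < 4 ^ K := by positivity
  set u : ℝ := 4 ^ K with hu_def
  set s : ℝ := (-1) ^ K with hs_def
  have hs : s * s = 1 := neg_one_pow_mul_self K
  have hb : 1 / (4 * u) * (8 / 7 * u ^ 2) = 2 / 7 * u := by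
    field_simp
    ring
  have hb0 : 0 < 1 / (4 * u) := by positivity
  refine exists_of_tower (κ := Fin 2) (K := K)
    (c := ![capForm s (1 / (4 * u)) 0, capForm (-s) (1 / (4 * u)) 0])
    (e := ![17 / 7 * u, 32 / 7 * u]) (m := 2 * K + 1) (by simp; ring)
    (M := 14 * u ^ 2) (fun x hx => ?_) ?_ ?_ (by omega) (by omega) lev
    (strictMono_lev.strictMonoOn _) (isTriangularLevel_lev ?_ ?_) lev_zero_pos
    (.inr ⟨rfl, ![0, 0, 4 * u ^ 2], vertical_mem_tower (by positivity) ?_, ?_⟩)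
  · have h := (mem_tower.1 hx).2
    have h0 := h 0
    have h1 := h 1
    simp only [Matrix.cons_val_zero, Matrix.cons_val_one, capForm_apply] at h0 h1
    have h2 : 1 / (4 * u) * x 2 ≤ 7 / 2 * u := by linarith
    rw [div_mul_eq_mul_div, div_le_iff₀ (by positivity)] at h2
    linarith
  · exact Fin.forall_fin_two.2 ⟨capForm_ne_zero _ hb0.ne' _, capForm_ne_zero _ hb0.ne' _⟩
  · refine Fin.forall_fin_two.2 ⟨?_, ?_⟩ <;> simp <;> positivity
  · intro x hx h
    have h0 := h 0
    have h1 := h 1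
    have h2 := h 2
    have h3 := (mul_le_mul_of_nonneg_left hx hb0.le).trans_eq hb
    simp only [triForm_zero, triForm_one, triForm_two] at h0 h1 h2
    refine Fin.forall_fin_two.2 ⟨?_, ?_⟩ <;>
    · simp only [Matrix.cons_val_zero, Matrix.cons_val_one, capForm_apply, triForm_zero]
      linarith
  · intro m d h1 h2
    have hd : ∀ r, r ≠ 0 → r * (d 2 / u) = 0 → d 2 = 0 := fun r hr h =>
      (div_eq_zero_iff.1 ((mul_eq_zero.1 h).resolve_left hr)).resolve_right hu.ne'
    have hdiv : 1 / (4 * u) * d 2 = 1 / 4 * (d 2 / u) := by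
      field_simp
    by_cases hm : m = 0
    · subst hm
      have h3 : capForm (-s) (1 / (4 * u)) 0 (corner s (15 / 7 * u) (8 / 7 * u ^ 2) 0) = 32 / 7 * u →
        capForm (-s) (1 / (4 * u)) 0 d = 0 := h2 1
      rw [capForm_apply, capForm_apply, corner_height, neg_mul, mul_triForm_corner hs, if_pos rfl,
        hb, hdiv, neg_mul] at h3
      have h4 := h3 (by ring)
      have h5 := h1 1 (by decide)
      have h6 := h1 2 (by decide)
      simp only [triForm_zero, triForm_one, triForm_two] at h4 h5 h6
      exact hd (9 / 4) (by norm_num) (by linarith)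
    · have h3 : capForm s (1 / (4 * u)) 0 (corner s (15 / 7 * u) (8 / 7 * u ^ 2) m) = 17 / 7 * u →
        capForm s (1 / (4 * u)) 0 d = 0 := h2 0
      rw [capForm_apply, capForm_apply, corner_height, mul_triForm_corner hs, if_neg (Ne.symm hm),
        hb, hdiv] at h3
      have h4 := h3 (by ring)
      have h5 := h1 0 (Ne.symm hm)
      exact hd (5 / 4) (by norm_num) (by linarith)
  · have h3 : 1 / (4 * u) * (4 * u ^ 2) = u := by
      field_simp
    refine Fin.forall_fin_two.2 ⟨?_, ?_⟩ <;>
    · simp [capForm_apply, -one_div, -mul_inv_rev, h3]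
      linarith
  · rw [Nat.add_sub_cancel, lev_two_mul, ← hu_def]
    simp
    linarith [pow_pos hu 2]

theorem hasDiameterAtLeast_pointed_cap (K : ℕ) : HasDiameterAtLeast (3 * K + 6) (2 * K + 3) := by
  have hu : (0 : ℝ) < 4 ^ K := by positivity
  set u : ℝ := 4 ^ K with hu_def
  set s : ℝ := (-1) ^ K with hs_def
  have hs : s * s = 1 := neg_one_pow_mul_self K
  have hs' : -s * -s = 1 := by rw [neg_mul_neg, hs]
  have hb : 5 / (8 * u) * (8 / 7 * u ^ 2) = 5 / 7 * u := by
    field_simp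
  have hb' : 5 / (8 * u) * (4 * u ^ 2) = 5 / 2 * u := by
    field_simp
    ring
  have hb0 : 0 < 5 / (8 * u) := by positivity
  have hu2 : u ^ 2 / u = u := by
    field_simp
  have hlast : lev (2 * K) < 4 * u ^ 2 := by
    rw [lev_two_mul, ← hu_def]
    linarith [pow_pos hu 2]
  have hd : ∀ r (d : Fin 3 → ℝ), r ≠ 0 → r * (d 2 / u) = 0 → d 2 = 0 := fun r d hr h =>
    (div_eq_zero_iff.1 ((mul_eq_zero.1 h).resolve_left hr)).resolve_right hu.ne'
  have hdiv : ∀ d : Fin 3 → ℝ, 5 / (8 * u) * d 2 = 5 / 8 * (d 2 / u) := fun d => by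
    field_simp
  set w : ℕ → ℝ := fun i => if i < 2 * K + 1 then lev i else 4 * u ^ 2 with hw
  have hw_lt : ∀ i < 2 * K + 1, w i = lev i := fun i hi => if_pos hi
  have hw_eq : w (2 * K + 1) = 4 * u ^ 2 := if_neg (lt_irrefl _)
  refine exists_of_tower (κ := Fin 3) (K := K) (c := capForm (-s) (5 / (8 * u)))
    (e := fun _ => 5 * u) (m := 2 * K + 2) (by simp; ring)
    (M := 8 * u ^ 2) (fun x hx => ?_) (capForm_ne_zero _ hb0.ne') (fun _ => by positivity)
    (by omega) (by omega) w ?_ ?_ ((hw_lt 0 (by omega)).symm ▸ lev_zero_pos)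
    (.inr ⟨rfl, ![0, 0, 6 * u ^ 2], vertical_mem_tower (by positivity) ?_, ?_⟩)
  · have h := (mem_tower.1 hx).2
    have h0 := h 0
    have h1 := h 1
    have h2 := h 2
    simp only [capForm_apply, triForm_zero, triForm_one, triForm_two] at h0 h1 h2
    have h2 : 5 / (8 * u) * x 2 ≤ 5 * u := by linarith
    rw [div_mul_eq_mul_div, div_le_iff₀ (by positivity)] at h2
    linarith
  · intro i _ j hj hij
    rw [Set.mem_Iio] at hj
    rw [hw_lt i (by omega)]
    rcases (show j ≤ 2 * K + 1 by omega).lt_or_eq with h | rfl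
    · rw [hw_lt j h]
      exact strictMono_lev hij
    · rw [hw_eq]
      exact (strictMono_lev.monotone (by omega)).trans_lt hlast
  · intro i hi
    rcases (show i ≤ 2 * K + 1 by omega).lt_or_eq with h | rfl
    · rw [hw_lt i h]
      refine isTriangularLevel_lev ?_ ?_ i h
      · intro x hx h
        have h0 := h 0
        have h1 := h 1
        have h2 := h 2
        have h3 := (mul_le_mul_of_nonneg_left hx hb0.le).trans_eq hb
        intro l
        simp only [triForm_zero, triForm_one, triForm_two] at h0 h1 h2
        rw [capForm_apply]
        fin_cases l <;> simp only [Fin.zero_eta, Fin.mk_one, Fin.reduceFinMk, triForm_zero,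
          triForm_one, triForm_two] <;> linarith
      · intro m d h1 h2
        have h3 := h2 m
        rw [capForm_apply, capForm_apply, corner_height, neg_mul, mul_triForm_corner hs, if_pos rfl,
          hb, hdiv, neg_mul] at h3
        have h4 := h3 (by ring)
        obtain ⟨k, l, hk, hl, hsum⟩ := sum_triForm m d
        have h5 := h1 k hk
        have h6 := h1 l hl
        rw [hsum] at h4
        exact hd (21 / 8) d (by norm_num) (by linarith)
    · rw [hw_eq]
      have hmul : ∀ m l, s * triForm l (corner (-s) (5 / 2 * u) (4 * u ^ 2) m) =
          if l = m then 5 * u else -(5 / 2 * u) := by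
        intro m l
        have := mul_triForm_corner (A := 5 / 2 * u) (w := 4 * u ^ 2) hs' m l
        split_ifs at this ⊢ <;> linarith
      refine isTriangularLevel_of_corner (s := -s) (A := 5 / 2 * u) hs' (by positivity)
        (fun m => mem_extremePoints_tower (mem_tower.2 ⟨fun j hj l => ?_, fun l => ?_⟩) ?_) ?_
      · rw [corner_height]
        by_cases hjK : j = K
        · subst hjK
          rw [← hs_def, ← hu_def, hmul, mul_div_assoc, hu2]
          split_ifs <;> linarith
        · have h1 := triForm_corner_bounds (w := 4 * u ^ 2) hs' (t := (-1) ^ j)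
            (by rw [neg_neg]; exact (neg_one_pow_eq_or_neg j K).symm)
            (A := 5 / 2 * u) (by positivity) m l
          have h2 := add_le_add_mul_div (p := 4 * u) (q := u) (v := 4 ^ j) (by positivity)
            (by rcases pow_four_le_or j K hjK with h | h
                · exact .inl ⟨by linarith, by linarith⟩
                · exact .inr ⟨by linarith, by linarith⟩)
          rw [show 4 * u ^ 2 = 4 * u * u by ring]
          rw [show 4 * u ^ 2 = 4 * u * u by ring] at h1
          linarith
      · rw [capForm_apply, corner_height, hb', mul_triForm_corner hs']
        split_ifs <;> linarith
      · intro d h1 h2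
        have h3 : ∀ l ≠ m, s * triForm l d = 5 / 8 * (d 2 / u) := by
          intro l hl
          have := h2 l (by
            rw [capForm_apply, corner_height, hb', mul_triForm_corner hs', if_neg hl]
            ring)
          rw [capForm_apply, hdiv] at this
          linarith
        have h4 := h1 K le_rfl m (by
          rw [← hs_def, ← hu_def, hmul, if_pos rfl, corner_height, mul_div_assoc, hu2]
          ring)
        rw [← hs_def, ← hu_def] at h4
        have h5 : d 2 = 0 := by
          obtain ⟨k, l, hk, hl, hsum⟩ := sum_triForm m d
          rw [hsum] at h4
          have h5 := h3 k hk
          have h6 := h3 l hl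
          exact hd (9 / 4) d (by norm_num) (by linarith)
        refine eq_zero_of_triForm (m := m) (fun l hl => ?_) h5
        have h6 := h3 l hl
        rw [h5, zero_div, mul_zero] at h6
        exact (mul_eq_zero.1 h6).resolve_left (pow_ne_zero _ (by norm_num))
      · intro x hx hxw m
        have h1 := (mem_tower.1 hx).2 m
        rw [capForm_apply, hxw, hb'] at h1
        linarith
  · intro l
    have h3 : 5 / (8 * u) * (6 * u ^ 2) = 15 / 4 * u := by
      field_simp
      ring
    rw [capForm_apply, triForm_vertical]
    simp only [Matrix.cons_val]
    linarith
  · rw [show 2 * K + 2 - 1 = 2 * K + 1 by omega, hw_eq]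
    simp only [Matrix.cons_val]
    linarith [pow_pos hu 2]

theorem hasDiameterAtLeast (n : ℕ) (hn : 4 ≤ n) : HasDiameterAtLeast n (2 * n / 3 - 1) := by
  obtain ⟨K, rfl | rfl | rfl⟩ : ∃ K, n = 3 * K + 4 ∨ n = 3 * K + 5 ∨ n = 3 * K + 6 :=
    ⟨(n - 4) / 3, by omega⟩
  · convert hasDiameterAtLeast_flat_cap K using 1
    omega
  · convert hasDiameterAtLeast_roof_cap K using 1
    omega
  · convert hasDiameterAtLeast_pointed_cap K using 1
    omega

end Caps

/-- (Klee) `H(n,3) = ⌊2n/3⌋ - 1`: every 3-polytope with `n` facets has diameter at most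
`⌊2n/3⌋ - 1`, and for every `n ≥ 4` this bound is attained. -/
theorem klee_H_n_3 :
    (∀ (S : Finset (Fin 3 → ℝ)) (n : ℕ), S.Nonempty →
      setDim (convexHull ℝ (S : Set (Fin 3 → ℝ))) = 3 →
      numFacets (convexHull ℝ (S : Set (Fin 3 → ℝ))) = n →
      ∀ a ∈ Set.extremePoints ℝ (convexHull ℝ (S : Set (Fin 3 → ℝ))),
        ∀ b ∈ Set.extremePoints ℝ (convexHull ℝ (S : Set (Fin 3 → ℝ))),
          ∃ L ≤ 2 * n / 3 - 1,
            HasPathOfLength (convexHull ℝ (S : Set (Fin 3 → ℝ))) a b L) ∧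
    (∀ n : ℕ, 4 ≤ n → ∃ S : Finset (Fin 3 → ℝ), S.Nonempty ∧
      setDim (convexHull ℝ (S : Set (Fin 3 → ℝ))) = 3 ∧
      numFacets (convexHull ℝ (S : Set (Fin 3 → ℝ))) = n ∧
      ∃ a ∈ Set.extremePoints ℝ (convexHull ℝ (S : Set (Fin 3 → ℝ))),
        ∃ b ∈ Set.extremePoints ℝ (convexHull ℝ (S : Set (Fin 3 → ℝ))),
          ∀ L : ℕ, HasPathOfLength (convexHull ℝ (S : Set (Fin 3 → ℝ))) a b L →
            2 * n / 3 - 1 ≤ L) := by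
  refine ⟨?_, hasDiameterAtLeast⟩
  rintro S n hS hdim rfl a ha b hb
  exact exists_path_le (by simp) S hS hdim ha hb
end
end

section
/- (Kalai–Kleitman) Let d ≥ 1 and n ≥ 1, let a : Fin n → (Fin d → ℝ) and b : Fin n → ℝ, and let P = { x : Fin d → ℝ | ∀ i, ⟪a i, x⟫ ≤ b i } be the polyhedron defined by these n inequalities. Then for any two extreme points u and v of P there is a path from u to v in the graph G(P) of length L with (L : ℝ) ≤ (n : ℝ) ^ (Real.logb 2 d + 2). -/
open scoped BigOperators

noncomputable section

namespace Polyhedron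

variable {E ι : Type*} [AddCommGroup E] [Module ℝ E]
  (a : ι → Module.Dual ℝ E) (b : ι → ℝ) (A : Finset ι) (W : Submodule ℝ E)

/-- `x` is a vertex of the polyhedron cut out in `x + W` by the inequalities `a i ≤ b i`,
`i ∈ A`: it is feasible and no nonzero direction of `W` preserves all tight constraints. -/
def IsVertex (x : E) : Prop :=
  (∀ i ∈ A, a i x ≤ b i) ∧ ∀ z ∈ W, (∀ i ∈ A, a i x = b i → a i z = 0) → z = 0

/-- The vertex-edge graph of the polyhedra cut out by `a i ≤ b i`, `i ∈ A`, in the translates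
of `W`, described through tight constraints. -/
def edgeGraph : SimpleGraph E where
  Adj x y := x ≠ y ∧ IsVertex a b A W x ∧ IsVertex a b A W y ∧ y - x ∈ W ∧
    ∀ z ∈ W, (∀ i ∈ A, a i x = b i → a i y = b i → a i z = 0) → ∃ t : ℝ, z = t • (y - x)
  symm := ⟨by
    rintro x y ⟨hne, hx, hy, hW, h⟩
    refine ⟨hne.symm, hy, hx, by simpa using W.neg_mem hW, fun z hz hzi => ?_⟩
    obtain ⟨t, rfl⟩ := h z hz fun i hi h₁ h₂ => hzi i hi h₂ h₁
    exact ⟨-t, by rw [← neg_sub x y, smul_neg, neg_smul]⟩⟩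
  loopless := ⟨fun _ h => h.1 rfl⟩

variable {a b A W}

/-- The ratio test: moving from a feasible point in a direction which some constraint bounds,
one stops at a feasible point where a new constraint becomes tight. -/
theorem exists_blocking {p z : E} (hp : ∀ i ∈ A, a i p ≤ b i) (hz : ∃ i ∈ A, 0 < a i z) :
    ∃ t : ℝ, 0 ≤ t ∧ (∀ i ∈ A, a i (p + t • z) ≤ b i) ∧
      ∃ j ∈ A, 0 < a j z ∧ a j (p + t • z) = b j := by
  classical
  obtain ⟨i, hi, hiz⟩ := hz
  obtain ⟨j, hj, hmin⟩ := (A.filter fun i => 0 < a i z).exists_min_image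
    (fun i => (b i - a i p) / a i z) ⟨i, by simp [hi, hiz]⟩
  obtain ⟨hjA, hjz⟩ := Finset.mem_filter.1 hj
  have ht : 0 ≤ (b j - a j p) / a j z := div_nonneg (sub_nonneg.2 (hp j hjA)) hjz.le
  refine ⟨(b j - a j p) / a j z, ht, fun k hk => ?_, j, hjA, hjz, ?_⟩
  · rw [map_add, map_smul, smul_eq_mul]
    rcases le_or_gt (a k z) 0 with hkz | hkz
    · linarith [hp k hk, mul_nonpos_of_nonneg_of_nonpos ht hkz]
    · have := (le_div_iff₀ hkz).1 (hmin k (Finset.mem_filter.2 ⟨hk, hkz⟩))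
      linarith
  · rw [map_add, map_smul, smul_eq_mul, div_mul_cancel₀ _ hjz.ne']
    ring

/-- Moving from a vertex along a direction of an edge until a constraint blocks produces an
adjacent vertex. -/
theorem adj_of_blocking {p z : E} {t : ℝ} (hp : IsVertex a b A W p) (hzW : z ∈ W) (ht : 0 < t)
    (hfeas : ∀ i ∈ A, a i (p + t • z) ≤ b i) {j : ι} (hj : j ∈ A) (hjz : a j z ≠ 0)
    (hjt : a j (p + t • z) = b j)
    (hedge : ∀ r ∈ W, (∀ i ∈ A, a i p = b i → a i z = 0 → a i r = 0) → ∃ s : ℝ, r = s • z) :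
    (edgeGraph a b A W).Adj p (p + t • z) := by
  have hz0 : z ≠ 0 := by
    rintro rfl
    simp at hjz
  refine ⟨?_, hp, ⟨hfeas, fun r hr hri => ?_⟩, by simpa using W.smul_mem t hzW,
    fun r hr hri => ?_⟩
  · simpa using ⟨ht.ne', hz0⟩
  · obtain ⟨s, rfl⟩ := hedge r hr fun i hi hip hiz => hri i hi (by simp [hip, hiz])
    have := hri j hj hjt
    rw [map_smul, smul_eq_mul] at this
    simp [(mul_eq_zero.1 this).resolve_right hjz]
  · obtain ⟨s, rfl⟩ := hedge r hr fun i hi hip hiz => hri i hi hip (by simp [hip, hiz])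
    exact ⟨s / t, by rw [add_sub_cancel_left, smul_smul, div_mul_cancel₀ _ ht.ne']⟩

/-- A pointed cone containing a direction of increase of `c` has an extreme ray along which `c`
increases. -/
theorem exists_extreme_ray {c : Module.Dual ℝ E}
    (hpt : ∀ z ∈ W, (∀ i ∈ A, a i z = 0) → z = 0) {z : E} (hzW : z ∈ W)
    (hz : ∀ i ∈ A, a i z ≤ 0) (hc : 0 < c z) :
    ∃ y ∈ W, (∀ i ∈ A, a i y ≤ 0) ∧ 0 < c y ∧
      ∀ r ∈ W, (∀ i ∈ A, a i y = 0 → a i r = 0) → ∃ s : ℝ, r = s • y := by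
  classical
  induction hk : (A.filter fun i => a i z ≠ 0).card using Nat.strong_induction_on
    generalizing z with
  | _ k ih =>
  by_contra hcon
  have hex : ∃ r ∈ W, (∀ i ∈ A, a i z = 0 → a i r = 0) ∧ ∀ s : ℝ, r ≠ s • z := by
    by_contra! h
    exact hcon ⟨z, hzW, hz, hc, h⟩
  obtain ⟨r, hrW, hr, hrs⟩ := hex
  obtain ⟨q, hqW, hq, hcq, hqi⟩ : ∃ q ∈ W, (∀ i ∈ A, a i z = 0 → a i q = 0) ∧ c q = 0 ∧
      ∃ i ∈ A, 0 < a i q := by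
    have hpW : r - (c r / c z) • z ∈ W := W.sub_mem hrW (W.smul_mem _ hzW)
    have hpz : ∀ i ∈ A, a i z = 0 → a i (r - (c r / c z) • z) = 0 := fun i hi h => by
      simp [hr i hi h, h]
    have hpc : c (r - (c r / c z) • z) = 0 := by simp [hc.ne']
    obtain ⟨i, hi, hip⟩ : ∃ i ∈ A, a i (r - (c r / c z) • z) ≠ 0 := by
      by_contra! h
      exact hrs _ (sub_eq_zero.1 (hpt _ hpW h))
    rcases hip.lt_or_gt with h | h
    · refine ⟨_, W.neg_mem hpW, fun i hi h => ?_, ?_, i, hi, ?_⟩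
      · rw [map_neg, hpz i hi h, neg_zero]
      · rw [map_neg, hpc, neg_zero]
      · rw [map_neg]
        exact neg_pos.2 h
    · exact ⟨_, hpW, hpz, hpc, i, hi, h⟩
  obtain ⟨t, -, hfeas, j, hj, hjq, hjt⟩ := exists_blocking (b := fun _ => (0 : ℝ)) hz hqi
  refine hcon (ih _ ?_ (W.add_mem hzW (W.smul_mem t hqW)) hfeas (by simpa [hcq]) rfl)
  rw [← hk]
  refine Finset.card_lt_card (Finset.ssubset_iff_of_subset ?_ |>.2 ⟨j, ?_, ?_⟩)
  · intro i hi
    rw [Finset.mem_filter] at hi ⊢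
    exact ⟨hi.1, fun h => hi.2 (by simp [h, hq i hi.1 h])⟩
  · exact Finset.mem_filter.2 ⟨hj, fun h => hjq.ne' (hq j hj h)⟩
  · exact fun h => (Finset.mem_filter.1 h).2 hjt

/-- The simplex step: a vertex which does not maximize a bounded functional has a better
neighbour. -/
theorem exists_improving_adj {c : Module.Dual ℝ E} {w y : E} (hw : IsVertex a b A W w)
    (hy : ∀ i ∈ A, a i y ≤ b i) (hyW : y - w ∈ W) (hc : c w < c y)
    (hmax : ∀ x, (∀ i ∈ A, a i x ≤ b i) → x - w ∈ W → c x ≤ c y) :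
    ∃ q, (edgeGraph a b A W).Adj w q ∧ c w < c q := by
  classical
  obtain ⟨z, hzW, hz, hcz, hedge⟩ := exists_extreme_ray (A := A.filter fun i => a i w = b i)
    (a := a) (c := c) (W := W) (z := y - w)
    (fun z hz h => hw.2 z hz fun i hi hiw => h i (Finset.mem_filter.2 ⟨hi, hiw⟩)) hyW
    (fun i hi => by
      obtain ⟨hi, hiw⟩ := Finset.mem_filter.1 hi
      rw [map_sub, hiw]
      exact sub_nonpos.2 (hy i hi)) (by rw [map_sub]; exact sub_pos.2 hc)
  have hblock : ∃ i ∈ A, 0 < a i z := by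
    by_contra! h
    have ht : 0 < (c y - c w) / c z + 1 :=
      add_pos (div_pos (sub_pos.2 hc) hcz) one_pos
    have := hmax (w + ((c y - c w) / c z + 1) • z)
      (fun i hi => by
        rw [map_add, map_smul, smul_eq_mul]
        linarith [hw.1 i hi, mul_nonpos_of_nonneg_of_nonpos ht.le (h i hi)])
      (by simpa using W.smul_mem _ hzW)
    rw [map_add, map_smul, smul_eq_mul, add_mul, div_mul_cancel₀ _ hcz.ne'] at this
    linarith
  obtain ⟨t, ht, hfeas, j, hj, hjz, hjt⟩ := exists_blocking hw.1 hblock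
  have ht : 0 < t := ht.lt_of_ne <| by
    rintro rfl
    exact (hz j (Finset.mem_filter.2 ⟨hj, by simpa using hjt⟩)).not_gt hjz
  refine ⟨w + t • z, adj_of_blocking hw hzW ht hfeas hj hjz.ne' hjt fun r hr h => ?_, ?_⟩
  · refine hedge r hr fun i hi => ?_
    obtain ⟨hi, hiw⟩ := Finset.mem_filter.1 hi
    exact h i hi hiw
  · rw [map_add, map_smul, smul_eq_mul]
    linarith [mul_pos ht hcz]

theorem IsVertex.of_walk {u v : E} (hu : IsVertex a b A W u) :
    (edgeGraph a b A W).Walk u v → IsVertex a b A W v ∧ v - u ∈ W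
  | .nil => ⟨hu, by simp⟩
  | .cons h p => by
    obtain ⟨hv, hW⟩ := IsVertex.of_walk h.2.2.1 p
    exact ⟨hv, by simpa using W.add_mem hW h.2.2.2.1⟩

/-- Vertices in one translate of `W` are determined by their tight constraints. -/
theorem IsVertex.eq_of_tight {u v : E} (hu : IsVertex a b A W u) (hW : v - u ∈ W)
    (h : ∀ i ∈ A, a i u = b i → a i v = b i) : v = u :=
  sub_eq_zero.1 <| hu.2 _ hW fun i hi hiu => by rw [map_sub, hiu, h i hi hiu, sub_self]

/-- The graph of a polyhedron is connected. -/
theorem IsVertex.reachable {u v : E} (hu : IsVertex a b A W u) (hv : IsVertex a b A W v)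
    (hW : v - u ∈ W) : (edgeGraph a b A W).Reachable u v := by
  classical
  set c : Module.Dual ℝ E := ∑ i ∈ A.filter (fun i => a i v = b i), a i with hcdef
  have hle : ∀ x, (∀ i ∈ A, a i x ≤ b i) →
      ∀ i ∈ A.filter (fun i => a i v = b i), a i x ≤ a i v := fun x hx i hi => by
    obtain ⟨hi, hiv⟩ := Finset.mem_filter.1 hi
    exact hiv ▸ hx i hi
  have hcv : ∀ x, (∀ i ∈ A, a i x ≤ b i) → c x ≤ c v := fun x hx => by
    simpa [hcdef] using Finset.sum_le_sum (hle x hx)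
  have hceq : ∀ x, (∀ i ∈ A, a i x ≤ b i) → x - v ∈ W → c x = c v → x = v := by
    intro x hx hxW h
    refine hv.eq_of_tight hxW fun i hi hiv => ?_
    rw [← hiv]
    simp only [hcdef, LinearMap.sum_apply] at h
    exact (Finset.sum_eq_sum_iff_of_le (hle x hx)).1 h i (Finset.mem_filter.2 ⟨hi, hiv⟩)
  have hfin : {x | (edgeGraph a b A W).Reachable u x}.Finite := by
    refine Set.Finite.of_finite_image (f := fun x => A.filter fun i => a i x = b i)
      ((Finset.finite_toSet A.powerset).subset ?_) ?_
    · rintro _ ⟨x, -, rfl⟩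
      exact Finset.mem_powerset.2 (Finset.filter_subset _ _)
    · rintro x ⟨p⟩ y ⟨q⟩ hxy
      obtain ⟨hy, hyW⟩ := hu.of_walk q
      refine hy.eq_of_tight (by simpa using W.sub_mem (hu.of_walk p).2 hyW) fun i hi hiy => ?_
      have : i ∈ A.filter fun i => a i x = b i := by
        rw [show (A.filter fun i => a i x = b i) = A.filter fun i => a i y = b i from hxy]
        exact Finset.mem_filter.2 ⟨hi, hiy⟩
      exact (Finset.mem_filter.1 this).2
  obtain ⟨w, ⟨p⟩, hmax⟩ := Set.exists_max_image _ c hfin ⟨u, .refl u⟩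
  obtain ⟨hw, hwW⟩ := hu.of_walk p
  have hvw : v - w ∈ W := by simpa using W.sub_mem hW hwW
  rcases (hcv w hw.1).eq_or_lt with h | h
  · exact hceq w hw.1 (by simpa using W.neg_mem hvw) h ▸ ⟨p⟩
  · obtain ⟨q, hq, hcq⟩ := exists_improving_adj hw hv.1 hvw h fun x hx _ => hcv x hx
    exact absurd (hmax q ⟨p.concat hq⟩) hcq.not_ge

/-- An edge of a relaxation issuing from `p` either is an edge of the polyhedron, or it starts
with an edge of the polyhedron which ends at a dropped constraint. -/
theorem adj_or_exists_of_relaxed_adj {I : Finset ι} (hI : I ⊆ A) {p q : E}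
    (hp : IsVertex a b A W p)
    (hpI : ∀ i ∈ A, a i p = b i → (∃ z ∈ W, a i z ≠ 0) → i ∈ I)
    (h : (edgeGraph a b I W).Adj p q) :
    (edgeGraph a b A W).Adj p q ∨ ∃ x, (edgeGraph a b A W).Adj p x ∧
      ∃ j ∈ A, a j x = b j ∧ (∃ z ∈ W, a j z ≠ 0) ∧ j ∉ I := by
  obtain ⟨hne, -, hq, hW, hedge⟩ := h
  by_cases hqA : ∀ i ∈ A, a i q ≤ b i
  · exact .inl ⟨hne, hp, ⟨hqA, fun z hz hzi => hq.2 z hz fun i hi => hzi i (hI hi)⟩, hW,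
      fun z hz hzi => hedge z hz fun i hi => hzi i (hI hi)⟩
  push Not at hqA
  obtain ⟨i, hi, hiq⟩ := hqA
  have hiz : 0 < a i (q - p) := by
    rw [map_sub]
    linarith [hp.1 i hi]
  obtain ⟨t, ht, hfeas, j, hj, hjz, hjt⟩ := exists_blocking hp.1 ⟨i, hi, hiz⟩
  have ht1 : t < 1 := by
    have := hfeas i hi
    rw [map_add, map_smul, smul_eq_mul] at this
    rw [map_sub] at hiz this
    by_contra! h
    nlinarith
  have hjI : j ∉ I := fun hjI => by
    have := hq.1 j hjI
    rw [map_add, map_smul, smul_eq_mul] at hjt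
    have h₂ := mul_lt_mul_of_pos_right ht1 hjz
    rw [map_sub] at hjt h₂
    linarith
  have ht0 : 0 < t := ht.lt_of_ne <| by
    rintro rfl
    exact hjI (hpI j hj (by simpa using hjt) ⟨_, hW, hjz.ne'⟩)
  refine .inr ⟨_, adj_of_blocking hp hW ht0 hfeas hj hjz.ne' hjt fun r hr hri => ?_,
    j, hj, hjt, ⟨_, hW, hjz.ne'⟩, hjI⟩
  exact hedge r hr fun k hk hkp hkq => hri k (hI hk) hkp (by rw [map_sub, hkp, hkq, sub_self])

/-- A walk in a relaxation that keeps every nontrivial constraint tight near `u` is a walk in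
the polyhedron itself. -/
theorem exists_walk_of_relaxed_walk {I : Finset ι} (hI : I ⊆ A) {u : E} {D : ℕ}
    (hD : ∀ x (p : (edgeGraph a b A W).Walk u x), p.length ≤ D → ∀ i ∈ A, a i x = b i →
      (∃ z ∈ W, a i z ≠ 0) → i ∈ I) (hu : IsVertex a b A W u) {x y : E}
    (p : (edgeGraph a b A W).Walk u x) (q : (edgeGraph a b I W).Walk x y)
    (hlen : p.length + q.length ≤ D) :
    ∃ r : (edgeGraph a b A W).Walk u y, r.length = p.length + q.length := by
  induction q with
  | nil => exact ⟨p, rfl⟩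
  | cons h q ih =>
    rw [SimpleGraph.Walk.length_cons] at hlen
    have hadj : (edgeGraph a b A W).Adj _ _ :=
      (adj_or_exists_of_relaxed_adj hI (hu.of_walk p).1 (hD _ p (by lia)) h).resolve_right <| by
        rintro ⟨x, hx, j, hj, hjx, hjW, hjI⟩
        exact hjI (hD x (p.concat hx) (by rw [SimpleGraph.Walk.length_concat]; lia) j hj hjx hjW)
    obtain ⟨r, hr⟩ := ih (p.concat hadj) (by rw [SimpleGraph.Walk.length_concat]; lia)
    exact ⟨r, by rw [hr, SimpleGraph.Walk.length_concat, SimpleGraph.Walk.length_cons]; lia⟩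

theorem IsVertex.face {x : E} (hx : IsVertex a b A W x) (i : ι) :
    IsVertex a b A (W ⊓ LinearMap.ker (a i)) x :=
  ⟨hx.1, fun z hz => hx.2 z hz.1⟩

theorem IsVertex.of_face {x : E} {i : ι} (hi : i ∈ A) (hix : a i x = b i)
    (hx : IsVertex a b A (W ⊓ LinearMap.ker (a i)) x) : IsVertex a b A W x :=
  ⟨hx.1, fun z hz h => hx.2 z ⟨hz, h i hi hix⟩ h⟩

/-- A walk in a face is a walk in the polyhedron. -/
theorem exists_walk_of_face_walk {i : ι} (hi : i ∈ A) {x y : E} (hix : a i x = b i)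
    (p : (edgeGraph a b A (W ⊓ LinearMap.ker (a i))).Walk x y) :
    ∃ q : (edgeGraph a b A W).Walk x y, q.length = p.length := by
  induction p with
  | nil => exact ⟨.nil, rfl⟩
  | cons h p ih =>
    obtain ⟨hne, hx, hy, hW, hedge⟩ := h
    have hiy := LinearMap.mem_ker.1 hW.2
    rw [map_sub, hix, sub_eq_zero] at hiy
    obtain ⟨q, hq⟩ := ih hiy
    exact ⟨.cons ⟨hne, hx.of_face hi hix, hy.of_face hi hiy, hW.1,
      fun z hz h => hedge z ⟨hz, h i hi hix hiy⟩ h⟩ q, congrArg (· + 1) hq⟩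

/-- The numerical recursion satisfied by the bound `n ^ (log₂ d + 2)`. -/
theorem bound_recursion {d n : ℕ} (hd : 1 ≤ d) (hn : 2 ≤ n) :
    2 * ((n / 2 : ℕ) : ℝ) ^ (Real.logb 2 ((d + 1 : ℕ) : ℝ) + 2) + 2 +
      ((n - 1 : ℕ) : ℝ) ^ (Real.logb 2 (d : ℝ) + 2) ≤
      (n : ℝ) ^ (Real.logb 2 ((d + 1 : ℕ) : ℝ) + 2) := by
  have hd' : (1 : ℝ) ≤ d := by exact_mod_cast hd
  have hn' : (2 : ℝ) ≤ n := by exact_mod_cast hn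
  have hn0 : (0 : ℝ) < n := by linarith
  push_cast
  have hlog : 0 ≤ Real.logb 2 (d : ℝ) := Real.logb_nonneg one_lt_two hd'
  have hlog' : 0 ≤ Real.logb 2 ((d : ℝ) + 1) := Real.logb_nonneg one_lt_two (by linarith)
  have htwo : (2 : ℝ) ^ (Real.logb 2 ((d : ℝ) + 1) + 2) = 4 * (d + 1) := by
    rw [Real.rpow_add two_pos, Real.rpow_logb two_pos (by norm_num) (by linarith)]
    norm_num
    ring
  set X : ℝ := (n : ℝ) ^ (Real.logb 2 ((d : ℝ) + 1) + 2) with hX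
  have hhalf : ((n / 2 : ℕ) : ℝ) ^ (Real.logb 2 ((d : ℝ) + 1) + 2) ≤ X / (4 * (d + 1)) := by
    rw [← htwo, hX, ← Real.div_rpow hn0.le two_pos.le]
    exact Real.rpow_le_rpow (by positivity) Nat.cast_div_le (by linarith)
  have hface : ((n - 1 : ℕ) : ℝ) ^ (Real.logb 2 (d : ℝ) + 2) ≤ X * (d / (d + 1)) := by
    have hexp : Real.logb 2 (d : ℝ) + 2 =
        (Real.logb 2 ((d : ℝ) + 1) + 2) + Real.logb 2 (d / (d + 1)) := by
      rw [Real.logb_div (by linarith) (by linarith)]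
      ring
    calc ((n - 1 : ℕ) : ℝ) ^ (Real.logb 2 (d : ℝ) + 2)
        ≤ (n : ℝ) ^ (Real.logb 2 (d : ℝ) + 2) :=
          Real.rpow_le_rpow (by positivity) (by exact_mod_cast Nat.sub_le n 1) (by linarith)
      _ = X * (n : ℝ) ^ Real.logb 2 ((d : ℝ) / (d + 1)) := by rw [hexp, Real.rpow_add hn0]
      _ ≤ X * (2 : ℝ) ^ Real.logb 2 ((d : ℝ) / (d + 1)) := by
          refine mul_le_mul_of_nonneg_left ?_ (by positivity)
          refine Real.rpow_le_rpow_of_nonpos two_pos hn' ?_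
          refine Real.logb_nonpos one_lt_two (by positivity) ?_
          rw [div_le_one (by linarith)]
          linarith
      _ = X * (d / (d + 1)) := by
          rw [Real.rpow_logb two_pos (by norm_num) (by positivity)]
  have hX4 : 4 * ((d : ℝ) + 1) ≤ X := by
    rw [← htwo]
    exact Real.rpow_le_rpow two_pos.le hn' (by linarith)
  have hsum : 2 * (X / (4 * ((d : ℝ) + 1))) + 2 + X * (d / (d + 1)) ≤ X := by
    have hY : 4 ≤ X / ((d : ℝ) + 1) := by
      rw [le_div_iff₀ (by linarith)]
      exact hX4
    have h₁ : X / (4 * ((d : ℝ) + 1)) = X / ((d : ℝ) + 1) / 4 := by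
      field_simp
    have h₂ : X * (d / (d + 1)) = X - X / ((d : ℝ) + 1) := by
      field_simp
      ring
    rw [h₁, h₂]
    linarith
  linarith

/-- If few constraints are met near `u`, then every vertex is near `u`. -/
theorem exists_walk_or_lt_card {u v : E} {k D : ℕ} (hu : IsVertex a b A W u)
    (hv : IsVertex a b A W v) (hW : v - u ∈ W)
    (ih : ∀ I ⊆ A, I.card ≤ k → ∀ x, IsVertex a b I W u → IsVertex a b I W x → x - u ∈ W →
      ∃ p : (edgeGraph a b I W).Walk u x, p.length ≤ D) :
    (∃ p : (edgeGraph a b A W).Walk u v, p.length ≤ D) ∨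
      ∃ I ⊆ A, k < I.card ∧ ∀ i ∈ I, (∃ z ∈ W, a i z ≠ 0) ∧
        ∃ x, a i x = b i ∧ ∃ p : (edgeGraph a b A W).Walk u x, p.length ≤ D + 1 := by
  classical
  set I : Finset ι := A.filter fun i => (∃ z ∈ W, a i z ≠ 0) ∧
    ∃ x, a i x = b i ∧ ∃ p : (edgeGraph a b A W).Walk u x, p.length ≤ D + 1 with hIdef
  have hIA : I ⊆ A := Finset.filter_subset _ _
  rcases lt_or_ge k I.card with hk | hk
  · exact .inr ⟨I, hIA, hk, fun i hi => (Finset.mem_filter.1 hi).2⟩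
  refine .inl ?_
  have htight : ∀ x (p : (edgeGraph a b A W).Walk u x), p.length ≤ D + 1 → ∀ i ∈ A,
      a i x = b i → (∃ z ∈ W, a i z ≠ 0) → i ∈ I := fun x p hp i hi hix hiW =>
    Finset.mem_filter.2 ⟨hi, hiW, x, hix, p, hp⟩
  have hvert : ∀ x (p : (edgeGraph a b A W).Walk u x), p.length ≤ D + 1 →
      IsVertex a b I W x := by
    refine fun x p hp => ⟨fun i hi => (hu.of_walk p).1.1 i (hIA hi), fun z hz h => ?_⟩
    refine (hu.of_walk p).1.2 z hz fun i hi hix => ?_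
    by_contra hiz
    exact hiz (h i (htight x p hp i hi hix ⟨z, hz, hiz⟩) hix)
  have hstep : ∀ x (p : (edgeGraph a b A W).Walk u x), p.length ≤ D + 1 →
      ∃ q : (edgeGraph a b A W).Walk u x, q.length ≤ D := by
    intro x p hp
    obtain ⟨q, hq⟩ := ih I hIA hk x (hvert u .nil (by simp)) (hvert x p hp) (hu.of_walk p).2
    obtain ⟨r, hr⟩ := exists_walk_of_relaxed_walk hIA htight hu .nil q
      (by rw [SimpleGraph.Walk.length_nil]; lia)
    exact ⟨r, by rw [hr, SimpleGraph.Walk.length_nil]; lia⟩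
  have hall : ∀ {x y : E} (_ : (edgeGraph a b A W).Walk x y)
      (p : (edgeGraph a b A W).Walk u x), p.length ≤ D →
      ∃ r : (edgeGraph a b A W).Walk u y, r.length ≤ D := by
    intro x y q
    induction q with
    | nil => exact fun p hp => ⟨p, hp⟩
    | cons h q ihq =>
      intro p hp
      obtain ⟨r, hr⟩ := hstep _ (p.concat h) (by rw [SimpleGraph.Walk.length_concat]; lia)
      exact ihq r hr
  obtain ⟨q⟩ := hu.reachable hv hW
  exact hall q .nil (by simp)

open Classical in
/-- The Kalai–Kleitman bound, where `n` bounds the number of constraints that are not constant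
on the translates of `W`. -/
theorem exists_walk_length_le [FiniteDimensional ℝ E] {d n : ℕ} (hd : 1 ≤ d) (hn : 1 ≤ n)
    (hdim : Module.finrank ℝ W ≤ d)
    (hcard : (A.filter fun i => ∃ z ∈ W, a i z ≠ 0).card ≤ n) {u v : E}
    (hu : IsVertex a b A W u) (hv : IsVertex a b A W v) (hW : v - u ∈ W) :
    ∃ p : (edgeGraph a b A W).Walk u v, (p.length : ℝ) ≤ (n : ℝ) ^ (Real.logb 2 (d : ℝ) + 2) := by
  induction d, hd using Nat.le_induction generalizing n A W u v with
  | base =>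
    have h1 : (1 : ℝ) ≤ (n : ℝ) ^ (Real.logb 2 ((1 : ℕ) : ℝ) + 2) :=
      Real.one_le_rpow (by exact_mod_cast hn) (by simp)
    by_cases huv : u = v
    · subst huv
      exact ⟨.nil, by simp⟩
    · suffices h : (edgeGraph a b A W).Adj u v from ⟨h.toWalk, by simpa using h1⟩
      refine ⟨huv, hu, hv, hW, fun z hz _ => ?_⟩
      have hne : (⟨v - u, hW⟩ : W) ≠ 0 := fun h =>
        huv (sub_eq_zero.1 (congrArg Subtype.val h)).symm
      obtain ⟨t, ht⟩ := exists_smul_eq_of_finrank_eq_one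
        (le_antisymm hdim (Module.finrank_pos_iff_exists_ne_zero.2 ⟨_, hne⟩)) hne ⟨z, hz⟩
      exact ⟨t, (congrArg Subtype.val ht).symm⟩
  | succ d hd ihd =>
    induction n using Nat.strong_induction_on generalizing A u v with
    | _ n ihn =>
    by_cases huv : u = v
    · subst huv
      exact ⟨.nil, by simpa using Real.rpow_nonneg n.cast_nonneg _⟩
    have htight : ∀ x, IsVertex a b A W x → ∃ i ∈ A, a i x = b i ∧ ∃ z ∈ W, a i z ≠ 0 := by
      intro x hx
      by_contra! h
      exact huv (sub_eq_zero.1 (hx.2 _ hW fun i hi hix => h i hi hix _ hW)).symm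
    have hn2 : 2 ≤ n := by
      by_contra! hlt
      refine huv (hu.eq_of_tight hW fun i hi hiu => ?_).symm
      by_cases hiW : ∃ z ∈ W, a i z ≠ 0
      · obtain ⟨j, hj, hjv, hjW⟩ := htight v hv
        rw [Finset.card_le_one.1 (hcard.trans (by lia)) i (Finset.mem_filter.2 ⟨hi, hiW⟩) j
          (Finset.mem_filter.2 ⟨hj, hjW⟩), hjv]
      · push Not at hiW
        have := hiW _ hW
        rw [map_sub, hiu] at this
        linarith
    have hrec := bound_recursion hd hn2
    set F : ℝ := ((n / 2 : ℕ) : ℝ) ^ (Real.logb 2 ((d + 1 : ℕ) : ℝ) + 2) with hF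
    have hF0 : 0 ≤ F := Real.rpow_nonneg (Nat.cast_nonneg _) _
    have hfl := Nat.floor_le hF0
    have hnear : ∀ w, ∀ I ⊆ A, I.card ≤ n / 2 → ∀ x, IsVertex a b I W w →
        IsVertex a b I W x → x - w ∈ W →
        ∃ p : (edgeGraph a b I W).Walk w x, p.length ≤ ⌊F⌋₊ := by
      intro w I _ hI x hw hx hwx
      obtain ⟨p, hp⟩ := ihn (n / 2) (by lia) (by lia)
        ((Finset.card_filter_le _ _).trans hI) hw hx hwx
      exact ⟨p, Nat.le_floor hp⟩
    have hface0 : 0 ≤ ((n - 1 : ℕ) : ℝ) ^ (Real.logb 2 (d : ℝ) + 2) :=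
      Real.rpow_nonneg (Nat.cast_nonneg _) _
    have hW' : u - v ∈ W := by simpa using W.neg_mem hW
    rcases exists_walk_or_lt_card hu hv hW (hnear u) with ⟨p, hp⟩ | ⟨I, hIA, hIk, hI⟩
    · have : (p.length : ℝ) ≤ ⌊F⌋₊ := by exact_mod_cast hp
      exact ⟨p, by linarith⟩
    rcases exists_walk_or_lt_card hv hu hW' (hnear v) with ⟨p, hp⟩ | ⟨J, hJA, hJk, hJ⟩
    · have : (p.length : ℝ) ≤ ⌊F⌋₊ := by exact_mod_cast hp
      exact ⟨p.reverse, by rw [SimpleGraph.Walk.length_reverse]; linarith⟩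
    obtain ⟨i, hiIJ⟩ : (I ∩ J).Nonempty := by
      refine Finset.inter_nonempty_of_card_lt_card_add_card
        (s := A.filter fun i => ∃ z ∈ W, a i z ≠ 0)
        (fun i hi => Finset.mem_filter.2 ⟨hIA hi, (hI i hi).1⟩)
        (fun i hi => Finset.mem_filter.2 ⟨hJA hi, (hJ i hi).1⟩) (by lia)
    obtain ⟨hiI, hiJ⟩ := Finset.mem_inter.1 hiIJ
    obtain ⟨⟨z, hz, hiz⟩, x, hix, p, hp⟩ := hI i hiI
    obtain ⟨-, y, hiy, q, hq⟩ := hJ i hiJ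
    obtain ⟨hx, hxW⟩ := hu.of_walk p
    obtain ⟨hy, hyW⟩ := hv.of_walk q
    have hlt : W ⊓ LinearMap.ker (a i) < W :=
      inf_le_left.lt_of_ne fun h => hiz (h.ge hz).2
    obtain ⟨r, hr⟩ := ihd (W := W ⊓ LinearMap.ker (a i)) (n := n - 1) (by lia)
      (by have := Submodule.finrank_lt_finrank_of_lt hlt; lia)
      (by
        refine Nat.le_sub_one_of_lt ((Finset.card_lt_card ?_).trans_le hcard)
        refine (Finset.ssubset_iff_of_subset fun j hj => ?_).2 ⟨i, ?_, ?_⟩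
        · obtain ⟨hj, z, hz, hjz⟩ := Finset.mem_filter.1 hj
          exact Finset.mem_filter.2 ⟨hj, z, hz.1, hjz⟩
        · exact Finset.mem_filter.2 ⟨hIA hiI, z, hz, hiz⟩
        · rintro hi
          obtain ⟨-, z, hz, hiz⟩ := Finset.mem_filter.1 hi
          exact hiz hz.2)
      (hx.face i) (hy.face i)
      ⟨by
        have := W.sub_mem (W.add_mem hyW hW) hxW
        simpa using this, LinearMap.mem_ker.2 (by rw [map_sub, hix, hiy, sub_self])⟩
    obtain ⟨s, hs⟩ := exists_walk_of_face_walk (hIA hiI) hix r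
    refine ⟨(p.append s).append q.reverse, ?_⟩
    have hp' : (p.length : ℝ) ≤ ⌊F⌋₊ + 1 := by exact_mod_cast hp
    have hq' : (q.length : ℝ) ≤ ⌊F⌋₊ + 1 := by exact_mod_cast hq
    rw [SimpleGraph.Walk.length_append, SimpleGraph.Walk.length_append,
      SimpleGraph.Walk.length_reverse, hs]
    push_cast at hrec ⊢
    linarith

/-- A constraint tight inside a feasible open segment is tight at its endpoints. -/
theorem tight_of_mem_openSegment {x y w : E} {i : ι} (hx : a i x ≤ b i) (hy : a i y ≤ b i)
    (hw : w ∈ openSegment ℝ x y) (hiw : a i w = b i) : a i x = b i := by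
  obtain ⟨s, t, hs, ht, hst, rfl⟩ := hw
  simp only [map_add, map_smul, smul_eq_mul] at hiw
  refine hx.antisymm (le_of_mul_le_mul_left ?_ hs)
  have := mul_le_mul_of_nonneg_left hy ht.le
  linear_combination this + b i * hst - hiw

section Extreme

variable [Fintype ι]

theorem isVertex_of_mem_extremePoints {x : E}
    (hx : x ∈ Set.extremePoints ℝ {x : E | ∀ i, a i x ≤ b i}) :
    IsVertex a b Finset.univ ⊤ x := by
  refine ⟨fun i _ => hx.1 i, fun z _ hz => ?_⟩
  have hev : ∀ᶠ ε : ℝ in nhdsWithin 0 (Set.Ioi 0),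
      ∀ i, a i (x + ε • z) ≤ b i ∧ a i (x - ε • z) ≤ b i := by
    refine Filter.eventually_all.2 fun i => ?_
    rcases (hx.1 i).eq_or_lt with h | h
    · simp [h, hz i (Finset.mem_univ i) h]
    · have h₁ : ∀ᶠ ε : ℝ in nhds 0, a i x + ε * a i z < b i :=
        ContinuousAt.eventually_lt (by fun_prop) continuousAt_const (by simpa using h)
      have h₂ : ∀ᶠ ε : ℝ in nhds 0, a i x - ε * a i z < b i :=
        ContinuousAt.eventually_lt (by fun_prop) continuousAt_const (by simpa using h)
      filter_upwards [nhdsWithin_le_nhds h₁, nhdsWithin_le_nhds h₂] with ε h₁ h₂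
      simp only [map_add, map_sub, map_smul, smul_eq_mul]
      exact ⟨h₁.le, h₂.le⟩
  obtain ⟨ε, hε, hε0⟩ := (hev.and self_mem_nhdsWithin).exists
  have : x + ε • z = x := (mem_extremePoints.1 hx).2 _ (fun i => (hε i).1) _
    (fun i => (hε i).2) ⟨1 / 2, 1 / 2, by norm_num, by norm_num, by norm_num, by module⟩ |>.1
  simpa [ne_of_gt hε0] using this

theorem IsVertex.mem_extremePoints {x : E} (hx : IsVertex a b Finset.univ ⊤ x) :
    x ∈ Set.extremePoints ℝ {x : E | ∀ i, a i x ≤ b i} := by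
  refine ⟨fun i => hx.1 i (Finset.mem_univ i), fun y hy z hz hxyz => ?_⟩
  exact hx.eq_of_tight trivial fun i _ hi => tight_of_mem_openSegment (hy i) (hz i) hxyz hi

/-- Stepping backwards from a vertex, away from another feasible point, is infeasible. -/
theorem IsVertex.nonneg_of_feasible {x y : E} {t : ℝ} (hx : IsVertex a b Finset.univ ⊤ x)
    (hy : ∀ i, a i y ≤ b i) (hne : x ≠ y) (h : ∀ i, a i (x + t • (y - x)) ≤ b i) : 0 ≤ t := by
  by_contra! ht
  refine hne (hx.eq_of_tight trivial fun i _ hi => (hy i).antisymm ?_).symm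
  have := h i
  simp only [map_add, map_smul, smul_eq_mul, map_sub, hi] at this
  nlinarith

theorem polyAdj_of_adj {x y : E} (h : (edgeGraph a b Finset.univ ⊤).Adj x y) :
    PolyAdj {x : E | ∀ i, a i x ≤ b i} x y := by
  obtain ⟨hne, hx, hy, -, hedge⟩ := h
  have hxP := hx.mem_extremePoints
  have hyP := hy.mem_extremePoints
  refine ⟨hne, hxP, hyP, ?_, ?_⟩
  · rintro _ ⟨s, t, hs, ht, hst, rfl⟩ i
    simp only [map_add, map_smul, smul_eq_mul]
    calc s * a i x + t * a i y ≤ s * b i + t * b i :=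
          add_le_add (mul_le_mul_of_nonneg_left (hxP.1 i) hs)
            (mul_le_mul_of_nonneg_left (hyP.1 i) ht)
      _ = b i := by rw [← add_mul, hst, one_mul]
  · rintro p hp q hq w ⟨s, t, hs, ht, hst, rfl⟩ hw
    obtain ⟨r, hr⟩ := hedge (p - x) trivial fun i _ hix hiy => by
      rw [map_sub, hix, sub_eq_zero]
      refine tight_of_mem_openSegment (hp i) (hq i) hw ?_
      simp only [map_add, map_smul, smul_eq_mul, hix, hiy]
      rw [← add_mul, hst, one_mul]
    have hpr : p = x + r • (y - x) := by rw [← hr]; abel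
    have hr0 : 0 ≤ r := hx.nonneg_of_feasible hyP.1 hne (hpr ▸ hp)
    have hpr' : p = y + (1 - r) • (x - y) := by rw [hpr]; module
    have hr1 : 0 ≤ 1 - r := hy.nonneg_of_feasible hxP.1 hne.symm (hpr' ▸ hp)
    exact ⟨1 - r, r, hr1, hr0, by ring, by rw [hpr]; module⟩

end Extreme

end Polyhedron

/-- (Kalai–Kleitman) Every `d`-dimensional polyhedron defined by `n` linear inequalities has
diameter at most `n ^ (log₂ d + 2)`. -/
theorem kalai_kleitman
    (d n : ℕ) (hd : 1 ≤ d) (hn : 1 ≤ n)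
    (a : Fin n → Fin d → ℝ) (b : Fin n → ℝ) :
    ∀ u ∈ Set.extremePoints ℝ {x : Fin d → ℝ | ∀ i, ∑ j, a i j * x j ≤ b i},
      ∀ v ∈ Set.extremePoints ℝ {x : Fin d → ℝ | ∀ i, ∑ j, a i j * x j ≤ b i},
        ∃ L : ℕ,
          HasPathOfLength {x : Fin d → ℝ | ∀ i, ∑ j, a i j * x j ≤ b i} u v L ∧
          (L : ℝ) ≤ (n : ℝ) ^ (Real.logb 2 (d : ℝ) + 2) := by
  set f : Fin n → Module.Dual ℝ (Fin d → ℝ) := fun i =>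
    ∑ j, a i j • LinearMap.proj j with hf
  have hfa : ∀ i x, f i x = ∑ j, a i j * x j := fun i x => by simp [hf]
  simp only [← hfa]
  intro u hu v hv
  classical
  obtain ⟨p, hp⟩ := Polyhedron.exists_walk_length_le (W := ⊤) hd hn (by simp)
    ((Finset.card_filter_le _ _).trans (by simp))
    (Polyhedron.isVertex_of_mem_extremePoints hu)
    (Polyhedron.isVertex_of_mem_extremePoints hv) trivial
  exact ⟨p.length, ⟨p.getVert, p.getVert_zero, p.getVert_length,
    fun i hi => Polyhedron.polyAdj_of_adj (p.adj_getVert_succ hi)⟩, hp⟩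
end
end
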